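/- Let 1 < q < p < ∞ and let s be a real number with −(1 − 1/p) < s < −(1 − 1/q). There exists a constant C (depending only on p, q, s and φ₀) such that for every integer N ≥ 1, every finite set E of Haar indices with #HF(E) ≤ 2^N, and every Schwartz function f : ℝ → ℂ, one has ‖P_E f‖_{F^s_{p,q}} ≤ C · 2^{N(−s−1+1/q)} · ‖f‖_{F^s_{p,q}}. -/

import Mathlib

open MeasureTheory Real FourierTransform
open scoped ENNReal

noncomputable section

def haarFn (j : ℕ) (μ : ℤ) : ℝ → ℂ := fun x =>
  (Set.Ico ((2:ℝ)^(-(j:ℤ)) * μ) ((2:ℝ)^(-(j:ℤ)) * (μ + 1/2))).indicator (fun _ => (1:ℂ)) x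
  - (Set.Ico ((2:ℝ)^(-(j:ℤ)) * (μ + 1/2)) ((2:ℝ)^(-(j:ℤ)) * (μ + 1))).indicator (fun _ => (1:ℂ)) x

def haarProj (E : Finset (ℕ × ℤ)) (f : ℝ → ℂ) : ℝ → ℂ := fun x =>
  ∑ e ∈ E, (2:ℂ)^e.1 * (∫ y : ℝ, f y * haarFn e.1 e.2 y) * haarFn e.1 e.2 x

def HFset (E : Finset (ℕ × ℤ)) : Finset ℕ := E.image Prod.fst

def conv (f g : ℝ → ℂ) : ℝ → ℂ := fun x => ∫ t : ℝ, f t * g (x - t)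

def LPop (φ₀ : ℝ → ℂ) (k : ℕ) (g : ℝ → ℂ) : ℝ → ℂ :=
  if k = 0 then conv g (𝓕⁻ φ₀)
  else conv g (fun x => (2:ℂ)^k * (𝓕⁻ (fun ξ => φ₀ ξ - φ₀ (2*ξ))) ((2:ℝ)^k * x))

def FNorm (φ₀ : ℝ → ℂ) (p q s : ℝ) (g : ℝ → ℂ) : ℝ≥0∞ :=
  (∫⁻ x : ℝ, (∑' k : ℕ, ENNReal.ofReal ((2:ℝ)^((k:ℝ)*s*q)) *
      (ENNReal.ofReal ‖LPop φ₀ k g x‖)^q)^(p/q) ∂volume)^(1/p)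

/-! ### Minkowski and Hölder inequalities for lower integrals -/

theorem lintegral_rpow_finset_sum_le {α ι : Type*} [MeasurableSpace α] {μ : Measure α}
    {f : ι → α → ℝ≥0∞} (hf : ∀ i, Measurable (f i)) {p : ℝ} (hp : 1 ≤ p) (S : Finset ι) :
    (∫⁻ x, (∑ i ∈ S, f i x) ^ p ∂μ) ^ (1 / p) ≤ ∑ i ∈ S, (∫⁻ x, f i x ^ p ∂μ) ^ (1 / p) := by
  classical
  have hp0 : 0 < p := by linarith
  induction S using Finset.induction_on with
  | empty => simp [hp0]
  | insert a S ha ih =>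
    simp only [Finset.sum_insert ha]
    refine (ENNReal.lintegral_Lp_add_le (hf a).aemeasurable
      (Finset.measurable_sum S fun i _ => hf i).aemeasurable hp).trans ?_
    gcongr

theorem lintegral_rpow_tsum_le {α ι : Type*} [Countable ι] [MeasurableSpace α] {μ : Measure α}
    {f : ι → α → ℝ≥0∞} (hf : ∀ i, Measurable (f i)) {p : ℝ} (hp : 1 ≤ p) :
    (∫⁻ x, (∑' i, f i x) ^ p ∂μ) ^ (1 / p) ≤ ∑' i, (∫⁻ x, f i x ^ p ∂μ) ^ (1 / p) := by
  have hp0 : 0 < p := by linarith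
  have hrw : ∀ x, (∑' i, f i x) ^ p = ⨆ S : Finset ι, (∑ i ∈ S, f i x) ^ p := fun x => by
    rw [ENNReal.tsum_eq_iSup_sum]
    exact (ENNReal.orderIsoRpow p hp0).map_iSup _
  simp_rw [hrw]
  rw [lintegral_iSup_directed
    (fun S => ((Finset.measurable_fun_sum S fun i _ => hf i).pow_const p).aemeasurable)]
  · have h := (ENNReal.orderIsoRpow (1 / p) (by positivity)).map_iSup
      (fun S : Finset ι => ∫⁻ x, (∑ i ∈ S, f i x) ^ p ∂μ)
    simp only [ENNReal.orderIsoRpow_apply] at h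
    rw [h]
    exact iSup_le fun S => (lintegral_rpow_finset_sum_le hf hp S).trans (ENNReal.sum_le_tsum S)
  · refine Monotone.directed_le fun S T hST x => ?_
    exact ENNReal.rpow_le_rpow (Finset.sum_le_sum_of_subset hST) hp0.le

/-- Hölder's inequality for a weighted integral. -/
theorem lintegral_mul_rpow_le {α : Type*} [MeasurableSpace α] {μ : Measure α}
    {w G : α → ℝ≥0∞} (hw : Measurable w) (hG : Measurable G) {t : ℝ} (ht : 1 ≤ t) :
    (∫⁻ x, w x * G x ∂μ) ^ t ≤ (∫⁻ x, w x ∂μ) ^ (t - 1) * ∫⁻ x, w x * G x ^ t ∂μ := by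
  rcases ht.eq_or_lt with rfl | ht
  · simp
  have ht0 : 0 < t := by linarith
  have hc : (t / (t - 1)).HolderConjugate t := (Real.HolderConjugate.conjExponent ht).symm
  have h := ENNReal.lintegral_mul_le_Lp_mul_Lq μ hc (f := fun x => w x ^ ((t - 1) / t))
    (g := fun x => w x ^ (1 / t) * G x) (hw.pow_const _).aemeasurable
    ((hw.pow_const _).mul hG).aemeasurable
  have h1 : ∀ x, ((fun x => w x ^ ((t - 1) / t)) * (fun x => w x ^ (1 / t) * G x)) x
      = w x * G x := fun x => by
    have ha : (0 : ℝ) ≤ (t - 1) / t := div_nonneg (by linarith) ht0.le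
    simp only [Pi.mul_apply]
    rw [← mul_assoc, ← ENNReal.rpow_add_of_nonneg _ _ ha (by positivity)]
    rw [show (t - 1) / t + 1 / t = 1 by field_simp; ring, ENNReal.rpow_one]
  have h2 : ∀ x, (w x ^ ((t - 1) / t)) ^ (t / (t - 1)) = w x := fun x => by
    rw [← ENNReal.rpow_mul, show (t - 1) / t * (t / (t - 1)) = 1 by
      have : t - 1 ≠ 0 := by linarith
      field_simp, ENNReal.rpow_one]
  have h3 : ∀ x, (w x ^ (1 / t) * G x) ^ t = w x * G x ^ t := fun x => by
    rw [ENNReal.mul_rpow_of_nonneg _ _ ht0.le, ← ENNReal.rpow_mul,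
      one_div_mul_cancel ht0.ne', ENNReal.rpow_one]
  simp only [h1, h2, h3] at h
  calc _ ≤ _ := ENNReal.rpow_le_rpow h ht0.le
    _ = _ := by
      rw [ENNReal.mul_rpow_of_nonneg _ _ ht0.le, ← ENNReal.rpow_mul, ← ENNReal.rpow_mul,
        one_div_mul_cancel ht0.ne', ENNReal.rpow_one]
      congr 2
      have : t - 1 ≠ 0 := by linarith
      field_simp

theorem ENNReal.add_rpow_le_rpow_add_mul (a c : ℝ≥0∞) {t : ℝ} (ht : 1 ≤ t) :
    (a + c) ^ t ≤ a ^ t + ENNReal.ofReal t * c * (a + c) ^ (t - 1) := by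
  have ht0 : 0 < t := by linarith
  rcases eq_or_ne a ∞ with rfl | ha
  · simp [ENNReal.top_rpow_of_pos ht0]
  rcases eq_or_ne c ∞ with rfl | hc
  · have h1 : (∞ : ℝ≥0∞) ^ (t - 1) ≠ 0 := by
      rcases ht.eq_or_lt with rfl | h
      · simp
      · rw [ENNReal.top_rpow_of_pos (by linarith)]; simp
    have h2 : ENNReal.ofReal t * ∞ = ∞ := ENNReal.mul_top (by simpa using ht0)
    simp [h2, ENNReal.top_mul h1]
  lift a to NNReal using ha
  lift c to NNReal using hc
  rcases eq_or_ne (a + c) 0 with h0 | h0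
  · have : a = 0 ∧ c = 0 := by simpa using h0
    simp [this.1, this.2, ht0]
  have hb : (0 : ℝ) < a + c := by
    have : 0 < a + c := pos_iff_ne_zero.2 h0
    exact_mod_cast this
  have key : ((a : ℝ) + c) ^ t ≤ (a : ℝ) ^ t + t * c * ((a : ℝ) + c) ^ (t - 1) := by
    have hB := one_add_mul_self_le_rpow_one_add (s := -(c / (a + c) : ℝ)) (by
      rw [neg_le_neg_iff, div_le_one hb]; simp) ht
    have e1 : 1 + -(c / (a + c) : ℝ) = a / (a + c) := by field_simp; ring
    rw [e1, Real.div_rpow a.coe_nonneg hb.le] at hB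
    have hbt : (0 : ℝ) < ((a : ℝ) + c) ^ t := Real.rpow_pos_of_pos hb _
    rw [le_div_iff₀ hbt] at hB
    have e2 : ((a : ℝ) + c) ^ (t - 1) = ((a : ℝ) + c) ^ t / (a + c) := by
      rw [Real.rpow_sub hb, Real.rpow_one]
    rw [e2]
    have : t * c * (((a : ℝ) + c) ^ t / (a + c)) = t * (c / (a + c)) * ((a : ℝ) + c) ^ t := by
      field_simp
    rw [this]
    nlinarith
  have hk : (a + c) ^ t ≤ a ^ t + t.toNNReal * c * (a + c) ^ (t - 1) := by
    rw [← NNReal.coe_le_coe]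
    push_cast
    rwa [Real.coe_toNNReal _ ht0.le]
  rw [ENNReal.ofReal, ← ENNReal.coe_add, ← ENNReal.coe_rpow_of_nonneg _ ht0.le,
    ← ENNReal.coe_rpow_of_nonneg _ ht0.le, ← ENNReal.coe_rpow_of_nonneg _ (by linarith : 0 ≤ t - 1),
    ← ENNReal.coe_mul, ← ENNReal.coe_mul, ← ENNReal.coe_add]
  exact_mod_cast hk

theorem ENNReal.sum_range_rpow_le (A : ℕ → ℝ≥0∞) {t : ℝ} (ht : 1 ≤ t) (n : ℕ) :
    (∑ j ∈ Finset.range n, A j) ^ t ≤ ENNReal.ofReal t *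
      ∑ j ∈ Finset.range n, A j * (∑ i ∈ Finset.range (j + 1), A i) ^ (t - 1) := by
  induction n with
  | zero => simp [show 0 < t by linarith]
  | succ n ih =>
    rw [Finset.sum_range_succ (fun j => A j * _), mul_add, Finset.sum_range_succ]
    refine (ENNReal.add_rpow_le_rpow_add_mul _ _ ht).trans ?_
    rw [mul_assoc]
    gcongr

/-! ### Averages against translation-invariant kernels -/

/-- The average of `G` against translates of the kernel `k`. -/
def kernelAvg (k : ℝ → ℝ≥0∞) (G : ℝ → ℝ≥0∞) (x : ℝ) : ℝ≥0∞ := ∫⁻ y, k (x - y) * G y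

theorem measurable_kernelAvg {k G : ℝ → ℝ≥0∞} (hk : Measurable k) (hG : Measurable G) :
    Measurable (kernelAvg k G) := by
  unfold kernelAvg
  refine Measurable.lintegral_prod_right' (f := fun z : ℝ × ℝ => k (z.1 - z.2) * G z.2) ?_
  fun_prop

theorem lintegral_kernelAvg {k G : ℝ → ℝ≥0∞} (hk : Measurable k) (hG : Measurable G) :
    ∫⁻ x, kernelAvg k G x = (∫⁻ u, k u) * ∫⁻ y, G y := by
  unfold kernelAvg
  rw [lintegral_lintegral_swap (by fun_prop)]
  have : ∀ y, ∫⁻ x, k (x - y) * G y = (∫⁻ u, k u) * G y := fun y => by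
    rw [lintegral_mul_const _ (by fun_prop), lintegral_sub_right_eq_self]
  simp_rw [this]
  rw [lintegral_const_mul _ hG]

theorem kernelAvg_rpow_le {k G : ℝ → ℝ≥0∞} (hk : Measurable k) (hG : Measurable G) {t : ℝ}
    (ht : 1 ≤ t) (x : ℝ) :
    kernelAvg k G x ^ t ≤ (∫⁻ u, k u) ^ (t - 1) * kernelAvg k (fun y => G y ^ t) x := by
  have := lintegral_mul_rpow_le (μ := volume) (w := fun y => k (x - y)) (by fun_prop) hG ht
  rwa [lintegral_sub_left_eq_self (fun u => k u)] at this

theorem kernelAvg_const_mul {k G : ℝ → ℝ≥0∞} (hk : Measurable k) (hG : Measurable G)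
    (c : ℝ≥0∞) (x : ℝ) :
    kernelAvg k (fun y => c * G y) x = c * kernelAvg k G x := by
  unfold kernelAvg
  rw [← lintegral_const_mul _ (by fun_prop)]
  congr with y
  ring

/-- The normalised indicator kernel of the interval of radius `r`. -/
def boxKernel (r : ℝ) : ℝ → ℝ≥0∞ :=
  fun u => (Metric.closedBall (0 : ℝ) r).indicator (fun _ => ENNReal.ofReal r⁻¹) u

theorem measurable_boxKernel (r : ℝ) : Measurable (boxKernel r) :=
  measurable_const.indicator Metric.isClosed_closedBall.measurableSet

theorem lintegral_boxKernel {r : ℝ} (hr : 0 < r) : ∫⁻ u, boxKernel r u = 2 := by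
  unfold boxKernel
  rw [lintegral_indicator Metric.isClosed_closedBall.measurableSet, setLIntegral_const,
    Real.volume_closedBall, ← ENNReal.ofReal_mul (by positivity)]
  rw [show r⁻¹ * (2 * r) = 2 by field_simp]
  simp

theorem boxKernel_sub_le {r r' x y : ℝ} (h : |x - y| ≤ r) (hrr : r ≤ r') (z : ℝ) :
    boxKernel r' (x - z) ≤ 2 * boxKernel (2 * r') (y - z) := by
  unfold boxKernel
  by_cases hz : x - z ∈ Metric.closedBall (0 : ℝ) r'
  · have hz' : y - z ∈ Metric.closedBall (0 : ℝ) (2 * r') := by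
      simp only [mem_closedBall_zero_iff, Real.norm_eq_abs] at hz ⊢
      rw [abs_le] at *
      constructor <;> linarith
    rw [Set.indicator_of_mem hz, Set.indicator_of_mem hz',
      show (2 : ℝ≥0∞) = ENNReal.ofReal 2 by simp, ← ENNReal.ofReal_mul (by norm_num)]
    apply ENNReal.ofReal_le_ofReal
    rw [mul_inv]; linarith
  · rw [Set.indicator_of_notMem hz]; exact zero_le

theorem lintegral_rpow_sum_boxKernel_le_of_doubling {t : ℝ} (ht : 1 < t) (n : ℕ) {G : ℕ → ℝ → ℝ≥0∞}
    (hG : ∀ j, Measurable (G j)) {r : ℕ → ℝ} (hr : ∀ j, 0 < r j) (hanti : Antitone r) :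
    ∫⁻ x, (∑ j ∈ Finset.range n, kernelAvg (boxKernel (r j)) (G j) x) ^ t ≤
      ENNReal.ofReal t * 2 ^ t * ((∫⁻ x, (∑ j ∈ Finset.range n, G j x) ^ t) ^ (1 / t) *
      (∫⁻ x, (∑ j ∈ Finset.range n, kernelAvg (boxKernel (2 * r j)) (G j) x) ^ t) ^ (1 - 1 / t)) := by
  have ht0 : 0 < t := by linarith
  have ht1 : 0 ≤ t - 1 := by linarith
  set S' : ℝ → ℝ≥0∞ := fun x => ∑ j ∈ Finset.range n, kernelAvg (boxKernel (2 * r j)) (G j) x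
    with hS'
  have mS' : Measurable S' := Finset.measurable_fun_sum _ fun j _ =>
    measurable_kernelAvg (measurable_boxKernel _) (hG j)
  have mA : ∀ j, Measurable (kernelAvg (boxKernel (r j)) (G j)) := fun j =>
    measurable_kernelAvg (measurable_boxKernel _) (hG j)
  have step : ∀ j ∈ Finset.range n, ∫⁻ x, kernelAvg (boxKernel (r j)) (G j) x *
      (∑ i ∈ Finset.range (j + 1), kernelAvg (boxKernel (r i)) (G i) x) ^ (t - 1) ≤
      2 ^ t * ∫⁻ y, G j y * S' y ^ (t - 1) := by
    intro j hj
    have hU : ∀ x y, boxKernel (r j) (x - y) *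
        (∑ i ∈ Finset.range (j + 1), kernelAvg (boxKernel (r i)) (G i) x) ^ (t - 1) ≤
        boxKernel (r j) (x - y) * (2 * S' y) ^ (t - 1) := by
      intro x y
      by_cases hxy : x - y ∈ Metric.closedBall (0 : ℝ) (r j)
      · gcongr
        rw [hS', Finset.mul_sum]
        refine (Finset.sum_le_sum (g := fun i => 2 * kernelAvg (boxKernel (2 * r i)) (G i) y)
          fun i hi => ?_).trans (Finset.sum_le_sum_of_subset ?_)
        · unfold kernelAvg
          have := measurable_boxKernel (2 * r i)
          have := hG i
          rw [← lintegral_const_mul _ (by fun_prop)]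
          refine lintegral_mono fun z => ?_
          rw [← mul_assoc]
          gcongr
          refine boxKernel_sub_le (r := r j) (by simpa using hxy) (hanti ?_) z
          have := Finset.mem_range.1 hi
          omega
        · intro i hi
          simp only [Finset.mem_range] at *
          omega
      · unfold boxKernel
        rw [Set.indicator_of_notMem hxy]; simp
    have := measurable_boxKernel (r j)
    have := hG j
    calc _ = ∫⁻ x, ∫⁻ y, boxKernel (r j) (x - y) * G j y *
          (∑ i ∈ Finset.range (j + 1), kernelAvg (boxKernel (r i)) (G i) x) ^ (t - 1) := by
          congr with x
          rw [lintegral_mul_const _ (by fun_prop)]; rfl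
      _ ≤ ∫⁻ x, ∫⁻ y, boxKernel (r j) (x - y) * (G j y * (2 * S' y) ^ (t - 1)) := by
          refine lintegral_mono fun x => lintegral_mono fun y => ?_
          have := mul_le_mul_right (hU x y) (G j y)
          calc _ = _ := by rw [mul_right_comm, mul_comm]
            _ ≤ _ := this
            _ = _ := by ring
      _ = ∫⁻ x, kernelAvg (boxKernel (r j)) (fun y => G j y * (2 * S' y) ^ (t - 1)) x := rfl
      _ = 2 * ∫⁻ y, G j y * (2 * S' y) ^ (t - 1) := by
          rw [lintegral_kernelAvg (by fun_prop) (by fun_prop), lintegral_boxKernel (hr j)]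
      _ = _ := by
          rw [← lintegral_const_mul _ (by fun_prop), ← lintegral_const_mul _ (by fun_prop)]
          congr with y
          rw [ENNReal.mul_rpow_of_nonneg _ _ ht1]
          have : (2 : ℝ≥0∞) ^ t = 2 * 2 ^ (t - 1) := by
            conv_lhs => rw [show t = 1 + (t - 1) by ring]
            rw [ENNReal.rpow_add_of_nonneg _ _ zero_le_one ht1, ENNReal.rpow_one]
          rw [this]; ring
  calc _ ≤ ∫⁻ x, ENNReal.ofReal t * ∑ j ∈ Finset.range n, kernelAvg (boxKernel (r j)) (G j) x *
        (∑ i ∈ Finset.range (j + 1), kernelAvg (boxKernel (r i)) (G i) x) ^ (t - 1) :=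
        lintegral_mono fun x => ENNReal.sum_range_rpow_le _ ht.le n
    _ = ENNReal.ofReal t * ∑ j ∈ Finset.range n, ∫⁻ x, kernelAvg (boxKernel (r j)) (G j) x *
        (∑ i ∈ Finset.range (j + 1), kernelAvg (boxKernel (r i)) (G i) x) ^ (t - 1) := by
        rw [lintegral_const_mul _ (by fun_prop), lintegral_finsetSum _ (by fun_prop)]
    _ ≤ ENNReal.ofReal t * ∑ j ∈ Finset.range n, 2 ^ t * ∫⁻ y, G j y * S' y ^ (t - 1) := by
        gcongr with j hj
        exact step j hj
    _ = ENNReal.ofReal t * 2 ^ t * ∫⁻ y, (∑ j ∈ Finset.range n, G j y) * S' y ^ (t - 1) := by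
        rw [← Finset.mul_sum, ← lintegral_finsetSum _ (by fun_prop), mul_assoc]
        simp_rw [Finset.sum_mul]
    _ ≤ _ := by
        gcongr
        have hc : t.HolderConjugate (t / (t - 1)) := Real.HolderConjugate.conjExponent ht
        have h := ENNReal.lintegral_mul_le_Lp_mul_Lq volume hc
          (f := fun y => ∑ j ∈ Finset.range n, G j y)
          (g := fun y => S' y ^ (t - 1)) (by fun_prop) (by fun_prop)
        have e : ∀ y, (S' y ^ (t - 1)) ^ (t / (t - 1)) = S' y ^ t := fun y => by
          rw [← ENNReal.rpow_mul]; congr 1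
          have : t - 1 ≠ 0 := by linarith
          field_simp
        simp only [e] at h
        rwa [show 1 / (t / (t - 1)) = 1 - 1 / t by field_simp] at h

theorem lintegral_rpow_sum_boxKernel_lt_top {t : ℝ} (ht : 1 < t) (n : ℕ) {G : ℕ → ℝ → ℝ≥0∞}
    (hG : ∀ j, Measurable (G j)) {r : ℕ → ℝ} (hr : ∀ j, 0 < r j) :
    ∫⁻ x, (∑ j ∈ Finset.range n, kernelAvg (boxKernel (r j)) (G j) x) ^ t ≤
      n ^ (t - 1) * (n * (2 ^ (t - 1) * (2 * ∫⁻ x, (∑ j ∈ Finset.range n, G j x) ^ t))) := by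
  have ht0 : 0 < t := by linarith
  have mA : ∀ j, Measurable (kernelAvg (boxKernel (r j)) (G j)) := fun j =>
    measurable_kernelAvg (measurable_boxKernel _) (hG j)
  calc _ ≤ ∫⁻ x, n ^ (t - 1) *
        ∑ j ∈ Finset.range n, kernelAvg (boxKernel (r j)) (G j) x ^ t := by
        refine lintegral_mono fun x => ?_
        simpa using ENNReal.rpow_sum_le_const_mul_sum_rpow (Finset.range n)
          (fun j => kernelAvg (boxKernel (r j)) (G j) x) ht.le
    _ = n ^ (t - 1) * ∑ j ∈ Finset.range n, ∫⁻ x, kernelAvg (boxKernel (r j)) (G j) x ^ t := by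
        rw [lintegral_const_mul _ (by fun_prop), lintegral_finsetSum _ (by fun_prop)]
    _ ≤ n ^ (t - 1) * ∑ j ∈ Finset.range n,
          (2 ^ (t - 1) * (2 * ∫⁻ x, (∑ j ∈ Finset.range n, G j x) ^ t)) := by
        gcongr with j hj
        calc _ ≤ ∫⁻ x, 2 ^ (t - 1) * kernelAvg (boxKernel (r j)) (fun y => G j y ^ t) x := by
              refine lintegral_mono fun x => ?_
              have := kernelAvg_rpow_le (measurable_boxKernel (r j)) (hG j) ht.le x
              rwa [lintegral_boxKernel (hr j)] at this
          _ = 2 ^ (t - 1) * (2 * ∫⁻ x, G j x ^ t) := by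
              have := measurable_kernelAvg (measurable_boxKernel (r j)) ((hG j).pow_const t)
              rw [lintegral_const_mul _ (by fun_prop),
                lintegral_kernelAvg (measurable_boxKernel _) ((hG j).pow_const t),
                lintegral_boxKernel (hr j)]
          _ ≤ _ := by
              gcongr with x
              exact Finset.single_le_sum (f := fun j => G j x) (fun _ _ => zero_le) hj
    _ = _ := by simp

theorem lintegral_rpow_sum_boxKernel_le {t : ℝ} (ht : 1 < t) (n : ℕ) {G : ℕ → ℝ → ℝ≥0∞}
    (hG : ∀ j, Measurable (G j)) {r : ℕ → ℝ} (hr : ∀ j, 0 < r j) (hanti : Antitone r) :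
    ∫⁻ x, (∑ j ∈ Finset.range n, kernelAvg (boxKernel (r j)) (G j) x) ^ t ≤
      (ENNReal.ofReal t * 2 ^ t) ^ t * ∫⁻ x, (∑ j ∈ Finset.range n, G j x) ^ t := by
  have ht0 : 0 < t := by linarith
  set B := ∫⁻ x, (∑ j ∈ Finset.range n, G j x) ^ t with hB
  set c := ENNReal.ofReal t * 2 ^ t with hc
  rcases eq_or_ne B ∞ with hBt | hBt
  · rw [hBt, ENNReal.mul_top]
    · exact le_top
    · simp [hc, ht0, ht0.le]
  set Y : ℝ≥0∞ := ⨆ r : {r : ℕ → ℝ // (∀ j, 0 < r j) ∧ Antitone r},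
    ∫⁻ x, (∑ j ∈ Finset.range n, kernelAvg (boxKernel (r.1 j)) (G j) x) ^ t with hY
  have hYt : Y ≠ ∞ := by
    refine ne_top_of_le_ne_top ?_ (iSup_le fun r =>
      lintegral_rpow_sum_boxKernel_lt_top ht n hG r.2.1)
    refine ENNReal.mul_ne_top (ENNReal.rpow_ne_top_of_nonneg (by linarith) (by simp)) ?_
    refine ENNReal.mul_ne_top (by simp) (ENNReal.mul_ne_top
      (ENNReal.rpow_ne_top_of_nonneg (by linarith) (by simp)) (ENNReal.mul_ne_top (by simp) hBt))
  have hYle : Y ≤ c * (B ^ (1 / t) * Y ^ (1 - 1 / t)) := by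
    refine iSup_le fun r => (lintegral_rpow_sum_boxKernel_le_of_doubling ht n hG r.2.1 r.2.2).trans ?_
    gcongr
    · rw [sub_nonneg, div_le_one ht0]; exact ht.le
    · exact le_iSup (fun r : {r : ℕ → ℝ // (∀ j, 0 < r j) ∧ Antitone r} =>
        ∫⁻ x, (∑ j ∈ Finset.range n, kernelAvg (boxKernel (r.1 j)) (G j) x) ^ t)
        ⟨fun j => 2 * r.1 j, fun j => by have := r.2.1 j; positivity,
          fun i j hij => by have := r.2.2 hij; simp only; linarith⟩
  refine (le_iSup (fun r : {r : ℕ → ℝ // (∀ j, 0 < r j) ∧ Antitone r} =>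
        ∫⁻ x, (∑ j ∈ Finset.range n, kernelAvg (boxKernel (r.1 j)) (G j) x) ^ t)
        ⟨r, hr, hanti⟩).trans (?_ : Y ≤ _)
  rcases eq_or_ne Y 0 with hY0 | hY0
  · rw [hY0]; exact zero_le
  have h1 : Y ^ (1 / t) * Y ^ (1 - 1 / t) ≤ c * B ^ (1 / t) * Y ^ (1 - 1 / t) := by
    rw [← ENNReal.rpow_add _ _ hY0 hYt, mul_assoc]
    simpa using hYle
  have h2 : Y ^ (1 / t) ≤ c * B ^ (1 / t) := by
    refine (ENNReal.mul_le_mul_iff_left ?_ ?_).1 h1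
    · simp [hY0, hYt]
    · exact ENNReal.rpow_ne_top_of_ne_zero hY0 hYt
  calc Y = (Y ^ (1 / t)) ^ t := by
        rw [← ENNReal.rpow_mul, one_div_mul_cancel ht0.ne', ENNReal.rpow_one]
    _ ≤ (c * B ^ (1 / t)) ^ t := ENNReal.rpow_le_rpow h2 ht0.le
    _ = _ := by
        rw [ENNReal.mul_rpow_of_nonneg _ _ ht0.le, ← ENNReal.rpow_mul,
          one_div_mul_cancel ht0.ne', ENNReal.rpow_one]

theorem lintegral_rpow_tsum_boxKernel_le {t : ℝ} (ht : 1 < t) {G : ℕ → ℝ → ℝ≥0∞}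
    (hG : ∀ j, Measurable (G j)) {r : ℕ → ℝ} (hr : ∀ j, 0 < r j) (hanti : Antitone r) :
    ∫⁻ x, (∑' j, kernelAvg (boxKernel (r j)) (G j) x) ^ t ≤
      (ENNReal.ofReal t * 2 ^ t) ^ t * ∫⁻ x, (∑' j, G j x) ^ t := by
  have ht0 : 0 < t := by linarith
  have mA : ∀ j, Measurable (kernelAvg (boxKernel (r j)) (G j)) := fun j =>
    measurable_kernelAvg (measurable_boxKernel _) (hG j)
  have hrw : ∀ x, (∑' j, kernelAvg (boxKernel (r j)) (G j) x) ^ t =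
      ⨆ n, (∑ j ∈ Finset.range n, kernelAvg (boxKernel (r j)) (G j) x) ^ t := fun x => by
    rw [ENNReal.tsum_eq_iSup_nat]
    exact (ENNReal.orderIsoRpow t ht0).map_iSup _
  simp_rw [hrw]
  rw [lintegral_iSup (fun n => by fun_prop)]
  · refine iSup_le fun n => (lintegral_rpow_sum_boxKernel_le ht n hG hr hanti).trans ?_
    gcongr with x
    exact ENNReal.sum_le_tsum _
  · intro m n hmn x
    exact ENNReal.rpow_le_rpow (Finset.sum_le_sum_of_subset (by simpa using hmn)) ht0.le

/-- The quadratically decaying kernel at frequency scale `R`. -/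
def etaKernel (R : ℝ) : ℝ → ℝ≥0∞ := fun u => ENNReal.ofReal (R / (1 + R * |u|) ^ 2)

theorem measurable_etaKernel (R : ℝ) : Measurable (etaKernel R) := by
  unfold etaKernel; fun_prop

theorem etaKernel_le {R : ℝ} (hR : 0 < R) (u : ℝ) :
    etaKernel R u ≤ ∑' n : ℕ, 4 * (2⁻¹ : ℝ≥0∞) ^ n * boxKernel (2 ^ n / R) u := by
  obtain ⟨n, h1, h2⟩ := exists_nat_pow_near (x := 1 + R * |u|) (y := 2)
    (by have : 0 ≤ R * |u| := by positivity
        linarith) (by norm_num)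
  refine le_trans ?_ (ENNReal.le_tsum (n + 1))
  have hu : u ∈ Metric.closedBall (0 : ℝ) (2 ^ (n + 1) / R) := by
    rw [mem_closedBall_zero_iff, Real.norm_eq_abs, le_div_iff₀ hR]
    linarith
  unfold boxKernel etaKernel
  rw [Set.indicator_of_mem hu]
  have e : (4 : ℝ≥0∞) * 2⁻¹ ^ (n + 1) = ENNReal.ofReal (4 * 2⁻¹ ^ (n + 1)) := by
    rw [ENNReal.ofReal_mul (by norm_num), ENNReal.ofReal_pow (by norm_num),
      ENNReal.ofReal_inv_of_pos (by norm_num)]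
    simp
  rw [e, ← ENNReal.ofReal_mul (by positivity)]
  apply ENNReal.ofReal_le_ofReal
  have h4 : ((2 : ℝ) ^ n) ^ 2 ≤ (1 + R * |u|) ^ 2 := by gcongr
  calc R / (1 + R * |u|) ^ 2 ≤ R / ((2 : ℝ) ^ n) ^ 2 := by gcongr
    _ = _ := by
      simp only [pow_succ, inv_pow]
      field_simp
      ring

theorem tsum_four_mul_inv_two_pow : ∑' n : ℕ, 4 * (2⁻¹ : ℝ≥0∞) ^ n = 8 := by
  rw [ENNReal.tsum_mul_left, ENNReal.tsum_geometric, ENNReal.one_sub_inv_two, inv_inv]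
  norm_num

theorem lintegral_etaKernel_le {R : ℝ} (hR : 0 < R) : ∫⁻ u, etaKernel R u ≤ 16 := by
  have := fun n : ℕ => measurable_boxKernel (2 ^ n / R)
  calc _ ≤ ∫⁻ u, ∑' n : ℕ, 4 * (2⁻¹ : ℝ≥0∞) ^ n * boxKernel (2 ^ n / R) u :=
        lintegral_mono fun u => etaKernel_le hR u
    _ = ∑' n : ℕ, 4 * (2⁻¹ : ℝ≥0∞) ^ n * 2 := by
        rw [lintegral_tsum (fun n => by fun_prop)]
        congr with n
        rw [lintegral_const_mul _ (by fun_prop), lintegral_boxKernel (by positivity)]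
    _ = 16 := by rw [ENNReal.tsum_mul_right, tsum_four_mul_inv_two_pow]; norm_num

theorem kernelAvg_etaKernel_le {R : ℝ} (hR : 0 < R) {G : ℝ → ℝ≥0∞} (hG : Measurable G) (x : ℝ) :
    kernelAvg (etaKernel R) G x ≤
      ∑' n : ℕ, 4 * (2⁻¹ : ℝ≥0∞) ^ n * kernelAvg (boxKernel (2 ^ n / R)) G x := by
  have := fun n : ℕ => measurable_boxKernel (2 ^ n / R)
  unfold kernelAvg
  calc _ ≤ ∫⁻ y, ∑' n : ℕ, 4 * (2⁻¹ : ℝ≥0∞) ^ n * (boxKernel (2 ^ n / R) (x - y) * G y) := by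
        refine lintegral_mono fun y => ?_
        simp_rw [← mul_assoc]
        rw [ENNReal.tsum_mul_right]
        gcongr
        exact etaKernel_le hR _
    _ = _ := by
        rw [lintegral_tsum (fun n => by fun_prop)]
        congr with n
        rw [lintegral_const_mul _ (by fun_prop)]

/-- Averaging a sequence of nonnegative functions over decreasing scales is bounded on
`L^t(ℓ^1)`, `t > 1`. -/
theorem lintegral_rpow_tsum_etaKernel_le {t : ℝ} (ht : 1 < t) {G : ℕ → ℝ → ℝ≥0∞}
    (hG : ∀ j, Measurable (G j)) {R : ℕ → ℝ} (hR : ∀ j, 0 < R j) (hmono : Monotone R) :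
    (∫⁻ x, (∑' j, kernelAvg (etaKernel (R j)) (G j) x) ^ t) ^ (1 / t) ≤
      8 * (ENNReal.ofReal t * 2 ^ t) * (∫⁻ x, (∑' j, G j x) ^ t) ^ (1 / t) := by
  have ht0 : 0 < t := by linarith
  set A : ℕ → ℝ → ℝ≥0∞ := fun n x => ∑' j, kernelAvg (boxKernel (2 ^ n / R j)) (G j) x with hA
  have mA : ∀ n, Measurable (A n) := fun n => Measurable.tsum fun j =>
    measurable_kernelAvg (measurable_boxKernel _) (hG j)
  calc _ ≤ (∫⁻ x, (∑' n : ℕ, 4 * (2⁻¹ : ℝ≥0∞) ^ n * A n x) ^ t) ^ (1 / t) := by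
        refine ENNReal.rpow_le_rpow (lintegral_mono fun x => ENNReal.rpow_le_rpow ?_ ht0.le)
          (by positivity)
        calc _ ≤ ∑' j, ∑' n : ℕ, 4 * (2⁻¹ : ℝ≥0∞) ^ n *
              kernelAvg (boxKernel (2 ^ n / R j)) (G j) x :=
              ENNReal.tsum_le_tsum fun j => kernelAvg_etaKernel_le (hR j) (hG j) x
          _ = _ := by
              rw [ENNReal.tsum_comm]
              simp_rw [hA, ENNReal.tsum_mul_left]
    _ ≤ ∑' n : ℕ, (∫⁻ x, (4 * (2⁻¹ : ℝ≥0∞) ^ n * A n x) ^ t) ^ (1 / t) :=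
        lintegral_rpow_tsum_le (fun n => by fun_prop) ht.le
    _ ≤ ∑' n : ℕ, 4 * (2⁻¹ : ℝ≥0∞) ^ n * ((ENNReal.ofReal t * 2 ^ t) *
          (∫⁻ x, (∑' j, G j x) ^ t) ^ (1 / t)) := by
        refine ENNReal.tsum_le_tsum fun n => ?_
        simp_rw [ENNReal.mul_rpow_of_nonneg _ _ ht0.le]
        rw [lintegral_const_mul _ (by fun_prop), ENNReal.mul_rpow_of_nonneg _ _ (by positivity),
          ← ENNReal.mul_rpow_of_nonneg _ _ ht0.le, ← ENNReal.rpow_mul, mul_one_div_cancel ht0.ne',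
          ENNReal.rpow_one]
        gcongr
        calc _ ≤ ((ENNReal.ofReal t * 2 ^ t) ^ t * ∫⁻ x, (∑' j, G j x) ^ t) ^ (1 / t) := by
              gcongr
              refine lintegral_rpow_tsum_boxKernel_le ht hG
                (fun j => by have := hR j; positivity) fun i j hij => ?_
              have := hR i
              have := hmono hij
              gcongr
          _ = _ := by
              rw [ENNReal.mul_rpow_of_nonneg _ _ (by positivity), ← ENNReal.rpow_mul,
                mul_one_div_cancel ht0.ne', ENNReal.rpow_one]
    _ = _ := by rw [ENNReal.tsum_mul_right, tsum_four_mul_inv_two_pow]; ring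

/-! ### Convolutions of Haar functions with dilated kernels -/

open SchwartzMap in
theorem SchwartzMap.exists_norm_le_div_sq (g : 𝓢(ℝ, ℂ)) :
    ∃ C : ℝ, 0 < C ∧ ∀ x, ‖g x‖ ≤ C / (1 + |x|) ^ 2 := by
  obtain ⟨C₀, h0, hC₀⟩ := g.decay 0 0
  obtain ⟨C₂, h2, hC₂⟩ := g.decay 2 0
  refine ⟨2 * (C₀ + C₂), by positivity, fun x => ?_⟩
  rw [le_div_iff₀ (by positivity)]
  have e0 := hC₀ x
  have e2 := hC₂ x
  simp only [pow_zero, one_mul, norm_iteratedFDeriv_zero, Real.norm_eq_abs, sq_abs] at e0 e2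
  have : (1 + |x|) ^ 2 ≤ 2 * (1 + x ^ 2) := by nlinarith [sq_abs x, sq_nonneg (1 - |x|)]
  nlinarith [mul_le_mul_of_nonneg_left this (norm_nonneg (g x))]

/-- The dyadic interval supporting `haarFn j μ`. -/
def haarIco (j : ℕ) (μ : ℤ) : Set ℝ :=
  Set.Ico ((2:ℝ)^(-(j:ℤ)) * μ) ((2:ℝ)^(-(j:ℤ)) * (μ + 1))

theorem integral_haarFn_mul (j : ℕ) (μ : ℤ) {g : ℝ → ℂ} (hg : Continuous g) :
    ∫ t, haarFn j μ t * g t =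
      (∫ t in ((2:ℝ)^(-(j:ℤ)) * μ)..((2:ℝ)^(-(j:ℤ)) * (μ + 1/2)), g t) -
      ∫ t in ((2:ℝ)^(-(j:ℤ)) * (μ + 1/2))..((2:ℝ)^(-(j:ℤ)) * (μ + 1)), g t := by
  have hd : (0:ℝ) < (2:ℝ)^(-(j:ℤ)) := by positivity
  have key : ∀ a b : ℝ, a ≤ b → Integrable (fun t => (Set.Ico a b).indicator (fun _ => (1:ℂ)) t * g t)
      ∧ ∫ t, (Set.Ico a b).indicator (fun _ => (1:ℂ)) t * g t = ∫ t in a..b, g t := by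
    intro a b hab
    have e : (fun t => (Set.Ico a b).indicator (fun _ => (1:ℂ)) t * g t)
        = (Set.Ico a b).indicator g := by
      ext t; by_cases ht : t ∈ Set.Ico a b <;> simp [ht]
    rw [e, integrable_indicator_iff measurableSet_Ico, integral_indicator measurableSet_Ico,
      intervalIntegral.integral_of_le hab, integral_Ico_eq_integral_Ioc]
    exact ⟨(hg.integrableOn_Icc).mono_set Set.Ico_subset_Icc_self, rfl⟩
  have h1 := key ((2:ℝ)^(-(j:ℤ)) * μ) ((2:ℝ)^(-(j:ℤ)) * (μ + 1/2)) (by nlinarith)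
  have h2 := key ((2:ℝ)^(-(j:ℤ)) * (μ + 1/2)) ((2:ℝ)^(-(j:ℤ)) * (μ + 1)) (by nlinarith)
  unfold haarFn
  simp_rw [sub_mul]
  rw [integral_sub h1.1 h2.1, h1.2, h2.2]

theorem norm_conv_haarFn_le_of_deriv {κ κ' : ℝ → ℂ} (hκ : ∀ x, HasDerivAt κ (κ' x) x) {C : ℝ}
    (hC : ∀ x, ‖κ' x‖ ≤ C / (1 + |x|) ^ 2) {R : ℝ} (hR : 0 < R) (j : ℕ) (hRj : R ≤ 2 ^ j)
    (μ : ℤ) {x y : ℝ} (hy : y ∈ haarIco j μ) :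
    ‖conv (haarFn j μ) (fun x => (R : ℂ) * κ (R * x)) x‖ ≤
      3 * C * (R / 2 ^ j) ^ 2 / (1 + R * |x - y|) ^ 2 := by
  have hC0 : 0 ≤ C := by have := (norm_nonneg _).trans (hC 0); simpa using this
  have hκc : Continuous κ := continuous_iff_continuousAt.2 fun x => (hκ x).continuousAt
  set e : ℝ := (2:ℝ)^(-(j:ℤ)) with he
  have he0 : 0 < e := by positivity
  have hRe : R * e ≤ 1 := by
    rw [he, zpow_neg, zpow_natCast, ← div_eq_mul_inv, div_le_one (by positivity)]; exact hRj
  have heq : e = 1 / 2 ^ j := by rw [he, zpow_neg, zpow_natCast, one_div]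
  unfold conv
  rw [integral_haarFn_mul j μ (g := fun t => (R : ℂ) * κ (R * (x - t))) (by fun_prop)]
  rw [← he]
  have hshift : ∫ t in (e * (μ + 1/2))..(e * (μ + 1)), (R : ℂ) * κ (R * (x - t)) =
      ∫ t in (e * μ)..(e * (μ + 1/2)), (R : ℂ) * κ (R * (x - (t + e / 2))) := by
    rw [intervalIntegral.integral_comp_add_right (fun t => (R : ℂ) * κ (R * (x - t)))]
    congr 1 <;> ring
  rw [hshift, ← intervalIntegral.integral_sub (by apply Continuous.intervalIntegrable; fun_prop)
    (by apply Continuous.intervalIntegrable; fun_prop)]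
  set D := 9 * C / (1 + R * |x - y|) ^ 2 with hD
  have hD0 : 0 ≤ D := by positivity
  have hb : ∀ t ∈ Set.uIoc (e * μ) (e * (μ + 1/2)),
      ‖(R : ℂ) * κ (R * (x - t)) - (R : ℂ) * κ (R * (x - (t + e / 2)))‖ ≤ R * (D * (R * (e / 2))) := by
    intro t ht
    rw [Set.uIoc_of_le (by nlinarith)] at ht
    rw [← mul_sub, norm_mul, Complex.norm_real, Real.norm_eq_abs, abs_of_pos hR]
    gcongr
    have hseg : ∀ v ∈ Set.Icc (R * (x - (t + e / 2))) (R * (x - t)), ‖κ' v‖ ≤ D := by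
      intro v hv
      refine (hC v).trans ?_
      rw [hD, show 9 * C / (1 + R * |x - y|) ^ 2 = C / ((1 + R * |x - y|) / 3) ^ 2 by
        field_simp; ring]
      have hyt : |R * (x - y) - v| ≤ 2 := by
        have hy1 := hy.1
        have hy2 := hy.2
        rw [← he] at hy1 hy2
        have t1 : R * (y - t) ≤ R * e := by gcongr; nlinarith [ht.1]
        have t2 : R * (t - y) ≤ R * e := by gcongr; nlinarith [ht.2]
        rw [abs_le]
        constructor <;> nlinarith [hv.1, hv.2]
      have h3 : 1 + R * |x - y| ≤ 3 * (1 + |v|) := by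
        have h4 : R * |x - y| = |R * (x - y)| := by rw [abs_mul, abs_of_pos hR]
        have h5 : |R * (x - y)| ≤ |R * (x - y) - v| + |v| := by
          simpa using abs_add_le (R * (x - y) - v) v
        have := abs_nonneg v
        linarith
      have h6 : (1 + R * |x - y|) / 3 ≤ 1 + |v| := by linarith
      gcongr
    have hle : R * (x - (t + e / 2)) ≤ R * (x - t) := by gcongr; linarith
    have := (convex_Icc (R * (x - (t + e / 2))) (R * (x - t))).norm_image_sub_le_of_norm_hasDerivWithin_le
      (fun v _ => (hκ v).hasDerivWithinAt) hseg (Set.left_mem_Icc.2 hle) (Set.right_mem_Icc.2 hle)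
    refine this.trans (le_of_eq ?_)
    rw [Real.norm_eq_abs, abs_of_nonneg (by linarith)]
    ring
  refine (intervalIntegral.norm_integral_le_of_norm_le_const hb).trans ?_
  rw [show e * (μ + 1/2) - e * μ = e / 2 by ring, abs_of_pos (by positivity), hD, heq,
    div_mul_eq_mul_div]
  rw [show R * (9 * C * (R * (1 / 2 ^ j / 2)) / (1 + R * |x - y|) ^ 2) * (1 / 2 ^ j / 2) =
    9 / 4 * (C * (R / 2 ^ j) ^ 2 / (1 + R * |x - y|) ^ 2) by field_simp; ring]
  rw [show 3 * C * (R / 2 ^ j) ^ 2 / (1 + R * |x - y|) ^ 2 =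
    3 * (C * (R / 2 ^ j) ^ 2 / (1 + R * |x - y|) ^ 2) by ring]
  gcongr
  norm_num

theorem norm_conv_haarFn_le_of_primitive {κ Ψ : ℝ → ℂ} (hΨ : ∀ x, HasDerivAt Ψ (κ x) x)
    (hκ : Continuous κ) {C : ℝ}
    (hC : ∀ x, ‖Ψ x‖ ≤ C / (1 + |x|) ^ 2) {R : ℝ} (hR : 0 < R) (j : ℕ) (μ : ℤ) (x : ℝ) :
    ‖conv (haarFn j μ) (fun x => (R : ℂ) * κ (R * x)) x‖ ≤
      C / (1 + R * |x - (2:ℝ)^(-(j:ℤ)) * μ|) ^ 2 +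
      2 * (C / (1 + R * |x - (2:ℝ)^(-(j:ℤ)) * (μ + 1/2)|) ^ 2) +
      C / (1 + R * |x - (2:ℝ)^(-(j:ℤ)) * (μ + 1)|) ^ 2 := by
  unfold conv
  rw [integral_haarFn_mul j μ (g := fun t => (R : ℂ) * κ (R * (x - t))) (by fun_prop)]
  have hd : ∀ t : ℝ, HasDerivAt (fun t => -Ψ (R * (x - t))) ((R : ℂ) * κ (R * (x - t))) t := by
    intro t
    have h1 : HasDerivAt (fun t : ℝ => R * (x - t)) (-R) t := by
      have := ((hasDerivAt_id t).const_sub x).const_mul R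
      simpa using this
    have h2 := ((hΨ (R * (x - t))).scomp t h1).neg
    refine h2.congr_deriv ?_
    simp
  rw [intervalIntegral.integral_eq_sub_of_hasDerivAt (fun t _ => hd t)
      (by apply Continuous.intervalIntegrable; fun_prop),
    intervalIntegral.integral_eq_sub_of_hasDerivAt (fun t _ => hd t)
      (by apply Continuous.intervalIntegrable; fun_prop)]
  have hb : ∀ c, ‖Ψ (R * (x - c))‖ ≤ C / (1 + R * |x - c|) ^ 2 := fun c => by
    have := hC (R * (x - c))
    rwa [abs_mul, abs_of_pos hR] at this
  set a := (2:ℝ)^(-(j:ℤ)) * μ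
  set b := (2:ℝ)^(-(j:ℤ)) * (μ + 1/2)
  set c := (2:ℝ)^(-(j:ℤ)) * (μ + 1)
  have e : -Ψ (R * (x - b)) - -Ψ (R * (x - a)) - (-Ψ (R * (x - c)) - -Ψ (R * (x - b))) =
      Ψ (R * (x - a)) - 2 * Ψ (R * (x - b)) + Ψ (R * (x - c)) := by ring
  rw [e]
  refine (norm_add_le _ _).trans (add_le_add ((norm_sub_le _ _).trans (add_le_add (hb a) ?_)) (hb c))
  rw [norm_mul]
  simpa using hb b

/-- The kernel `κ₀` for `k = 0`, and the `L¹`-dilation of `κ₁` by `2 ^ k` for `k ≥ 1`. -/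
def dilKernel (κ₀ κ₁ : ℝ → ℂ) (k : ℕ) (x : ℝ) : ℂ :=
  if k = 0 then κ₀ x else (2:ℂ)^k * κ₁ ((2:ℝ)^k * x)

theorem dilKernel_eq_of_ne_zero (κ₀ κ₁ : ℝ → ℂ) {k : ℕ} (hk : k ≠ 0) :
    dilKernel κ₀ κ₁ k = fun x => (((2:ℝ)^k : ℝ) : ℂ) * κ₁ ((2:ℝ)^k * x) := by
  ext x
  simp [dilKernel, hk]

theorem dilKernel_zero (κ₀ κ₁ : ℝ → ℂ) :
    dilKernel κ₀ κ₁ 0 = fun x => ((1 : ℝ) : ℂ) * κ₀ (1 * x) := by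
  ext x
  simp [dilKernel]

theorem ofReal_div_one_add_sq {R : ℝ} (hR : 0 < R) {A : ℝ} (hA : 0 ≤ A) (u : ℝ) :
    ENNReal.ofReal (A / (1 + R * |u|) ^ 2) = ENNReal.ofReal (A / R) * etaKernel R u := by
  unfold etaKernel
  rw [← ENNReal.ofReal_mul (by positivity)]
  congr 1
  field_simp

theorem one_div_one_add_sq_le_of_abs_sub_le {Q R x c y : ℝ} (hQ : 0 < Q) (hQR : Q ≤ R)
    (h : Q * |y - c| ≤ 1) {C : ℝ} (hC : 0 ≤ C) :
    C / (1 + R * |x - c|) ^ 2 ≤ 4 * C / (1 + Q * |x - y|) ^ 2 := by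
  rw [show 4 * C / (1 + Q * |x - y|) ^ 2 = C / ((1 + Q * |x - y|) / 2) ^ 2 by field_simp; ring]
  have h1 : Q * |x - y| ≤ Q * |x - c| + Q * |y - c| := by
    rw [← mul_add]
    gcongr
    have := abs_sub_le x c y
    rwa [abs_sub_comm c y] at this
  have h2 : Q * |x - c| ≤ R * |x - c| := by gcongr
  have hR : 0 < R := hQ.trans_le hQR
  have h3 : 0 ≤ R * |x - c| := by positivity
  have h4 : (1 + Q * |x - y|) / 2 ≤ 1 + R * |x - c| := by linarith
  gcongr

open SchwartzMap in
theorem exists_conv_haarFn_bounds (κ₀ κ₁ Ψ : 𝓢(ℝ, ℂ)) (hΨ : ∀ x, HasDerivAt Ψ (κ₁ x) x) :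
    ∃ C : ℝ, 0 < C ∧ (∀ k j μ x y, y ∈ haarIco j μ → k ≤ j →
        ‖conv (haarFn j μ) (dilKernel κ₀ κ₁ k) x‖ₑ ≤
          ENNReal.ofReal C * ENNReal.ofReal (2 ^ k / (2 ^ j) ^ 2) * etaKernel (2 ^ k) (x - y)) ∧
      (∀ k j μ x y, y ∈ haarIco j μ → j ≤ k →
        ‖conv (haarFn j μ) (dilKernel κ₀ κ₁ k) x‖ₑ ≤
          ENNReal.ofReal C * ENNReal.ofReal (1 / 2 ^ j) * etaKernel (2 ^ j) (x - y)) ∧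
      (∀ k j μ, j ≤ k → ∫⁻ x, ‖conv (haarFn j μ) (dilKernel κ₀ κ₁ k) x‖ₑ ≤
          ENNReal.ofReal C * ENNReal.ofReal (1 / 2 ^ k)) := by
  obtain ⟨A₀, hA₀, h₀⟩ := (derivCLM ℝ ℂ κ₀).exists_norm_le_div_sq
  obtain ⟨A₁, hA₁, h₁⟩ := (derivCLM ℝ ℂ κ₁).exists_norm_le_div_sq
  obtain ⟨A₂, hA₂, h₂⟩ := Ψ.exists_norm_le_div_sq
  simp only [derivCLM_apply] at h₀ h₁
  have d₀ : ∀ x, HasDerivAt κ₀ (deriv κ₀ x) x := fun x => κ₀.differentiableAt.hasDerivAt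
  have d₁ : ∀ x, HasDerivAt κ₁ (deriv κ₁ x) x := fun x => κ₁.differentiableAt.hasDerivAt
  set A := A₀ + A₁ + A₂ with hA
  have hA0 : 0 < A := by positivity
  have bA : ∀ k j μ x y, y ∈ haarIco j μ → k ≤ j →
        ‖conv (haarFn j μ) (dilKernel κ₀ κ₁ k) x‖ₑ ≤
          ENNReal.ofReal (4 * A) * ENNReal.ofReal (2 ^ k / (2 ^ j) ^ 2) *
            etaKernel (2 ^ k) (x - y) := by
    intro k j μ x y hy hkj
    have hk : (2:ℝ) ^ k ≤ 2 ^ j := by gcongr; norm_num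
    have hb : ‖conv (haarFn j μ) (dilKernel κ₀ κ₁ k) x‖ ≤
        4 * A * (2 ^ k / 2 ^ j) ^ 2 / (1 + 2 ^ k * |x - y|) ^ 2 := by
      rcases eq_or_ne k 0 with rfl | hk0
      · rw [dilKernel_zero]
        refine (norm_conv_haarFn_le_of_deriv d₀ h₀ one_pos j (by simpa using hk) μ hy).trans ?_
        rw [pow_zero]
        gcongr <;> linarith
      · rw [dilKernel_eq_of_ne_zero _ _ hk0]
        refine (norm_conv_haarFn_le_of_deriv d₁ h₁ (by positivity) j hk μ hy).trans ?_
        gcongr <;> linarith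
    rw [← ofReal_norm]
    refine (ENNReal.ofReal_le_ofReal hb).trans (le_of_eq ?_)
    rw [ofReal_div_one_add_sq (by positivity) (by positivity),
      ← ENNReal.ofReal_mul (by positivity)]
    congr 2
    field_simp
  have hI : ∀ (j : ℕ) (μ : ℤ), (2:ℝ)^(-(j:ℤ)) * μ ∈ haarIco j μ := fun j μ => by
    have : (0:ℝ) < (2:ℝ)^(-(j:ℤ)) := by positivity
    exact ⟨le_rfl, by nlinarith⟩
  refine ⟨64 * A, by positivity, fun k j μ x y hy hkj => ?_, fun k j μ x y hy hjk => ?_,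
    fun k j μ hjk => ?_⟩
  · refine (bA k j μ x y hy hkj).trans ?_
    gcongr
    norm_num
  · rcases eq_or_ne k 0 with rfl | hk0
    · obtain rfl : j = 0 := by omega
      refine (bA 0 0 μ x y hy le_rfl).trans ?_
      simp only [pow_zero, one_pow]
      gcongr
      norm_num
    · rw [dilKernel_eq_of_ne_zero _ _ hk0]
      have hjk' : (2:ℝ) ^ j ≤ 2 ^ k := by gcongr; norm_num
      have hb := norm_conv_haarFn_le_of_primitive hΨ κ₁.continuous h₂
        (by positivity : (0:ℝ) < 2 ^ k) j μ x
      have hc : ∀ c : ℝ, (2:ℝ)^(-(j:ℤ)) * μ ≤ c → c ≤ (2:ℝ)^(-(j:ℤ)) * (μ + 1) →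
          (2:ℝ) ^ j * |y - c| ≤ 1 := by
        intro c hc1 hc2
        have : |y - c| ≤ (2:ℝ)^(-(j:ℤ)) := by
          rw [abs_le]; constructor <;> nlinarith [hy.1, hy.2]
        calc (2:ℝ) ^ j * |y - c| ≤ 2 ^ j * (2:ℝ)^(-(j:ℤ)) := by gcongr
          _ = 1 := by rw [zpow_neg, zpow_natCast, mul_inv_cancel₀ (by positivity)]
      have he : (0:ℝ) < (2:ℝ)^(-(j:ℤ)) := by positivity
      have b1 := one_div_one_add_sq_le_of_abs_sub_le (x := x) (by positivity) hjk'
        (hc ((2:ℝ)^(-(j:ℤ)) * μ) le_rfl (by nlinarith)) hA₂.le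
      have b2 := one_div_one_add_sq_le_of_abs_sub_le (x := x) (by positivity) hjk'
        (hc ((2:ℝ)^(-(j:ℤ)) * (μ + 1/2)) (by nlinarith) (by nlinarith)) hA₂.le
      have b3 := one_div_one_add_sq_le_of_abs_sub_le (x := x) (by positivity) hjk'
        (hc ((2:ℝ)^(-(j:ℤ)) * (μ + 1)) (by nlinarith) le_rfl) hA₂.le
      have hle : 16 * A₂ / (1 + 2 ^ j * |x - y|) ^ 2 ≤ 64 * A / (1 + 2 ^ j * |x - y|) ^ 2 := by
        have : A₂ ≤ A := by linarith
        gcongr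
        norm_num
      rw [← ofReal_norm]
      refine (ENNReal.ofReal_le_ofReal (hb.trans (?_ : _ ≤
        64 * A / (1 + 2 ^ j * |x - y|) ^ 2))).trans (le_of_eq ?_)
      · refine le_trans ?_ hle
        have : 16 * A₂ / (1 + 2 ^ j * |x - y|) ^ 2 = 4 * (4 * A₂ / (1 + 2 ^ j * |x - y|) ^ 2) := by
          ring
        linarith
      · rw [ofReal_div_one_add_sq (by positivity) (by positivity),
          ← ENNReal.ofReal_mul (by positivity)]
        congr 2
        ring
  · rcases eq_or_ne k 0 with rfl | hk0
    · obtain rfl : j = 0 := by omega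
      have := measurable_etaKernel ((2:ℝ) ^ 0)
      calc _ ≤ ∫⁻ x, ENNReal.ofReal (4 * A) * ENNReal.ofReal (2 ^ 0 / (2 ^ 0) ^ 2) *
            etaKernel (2 ^ 0) (x - (2:ℝ)^(-((0:ℕ):ℤ)) * μ) :=
            lintegral_mono fun x => bA 0 0 μ x _ (hI 0 μ) le_rfl
        _ ≤ ENNReal.ofReal (4 * A) * ENNReal.ofReal (2 ^ 0 / (2 ^ 0) ^ 2) * 16 := by
            rw [lintegral_const_mul _ (by fun_prop), lintegral_sub_right_eq_self]
            gcongr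
            exact lintegral_etaKernel_le (by positivity)
        _ = _ := by
            simp only [pow_zero, one_pow, div_one, ENNReal.ofReal_one, mul_one]
            rw [show (16 : ℝ≥0∞) = ENNReal.ofReal 16 by simp, ← ENNReal.ofReal_mul (by positivity)]
            congr 1; ring
    · rw [dilKernel_eq_of_ne_zero _ _ hk0]
      have hR : (0:ℝ) < 2 ^ k := by positivity
      have := measurable_etaKernel ((2:ℝ) ^ k)
      set E := ENNReal.ofReal (A₂ / 2 ^ k) with hE
      calc _ ≤ ∫⁻ x, E * (etaKernel (2 ^ k) (x - (2:ℝ)^(-(j:ℤ)) * μ) +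
            2 * etaKernel (2 ^ k) (x - (2:ℝ)^(-(j:ℤ)) * (μ + 1/2)) +
            etaKernel (2 ^ k) (x - (2:ℝ)^(-(j:ℤ)) * (μ + 1))) := by
            refine lintegral_mono fun x => ?_
            have hb := norm_conv_haarFn_le_of_primitive hΨ κ₁.continuous h₂ hR j μ x
            rw [← ofReal_norm]
            refine (ENNReal.ofReal_le_ofReal hb).trans (le_of_eq ?_)
            rw [ENNReal.ofReal_add (by positivity) (by positivity),
              ENNReal.ofReal_add (by positivity) (by positivity),
              ENNReal.ofReal_mul (by norm_num), ofReal_div_one_add_sq hR hA₂.le,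
              ofReal_div_one_add_sq hR hA₂.le, ofReal_div_one_add_sq hR hA₂.le, ← hE]
            simp only [ENNReal.ofReal_ofNat]
            ring
        _ ≤ E * (16 + 2 * 16 + 16) := by
            rw [lintegral_const_mul _ (by fun_prop), lintegral_add_left (by fun_prop),
              lintegral_add_left (by fun_prop), lintegral_const_mul _ (by fun_prop),
              lintegral_sub_right_eq_self, lintegral_sub_right_eq_self,
              lintegral_sub_right_eq_self]
            have := lintegral_etaKernel_le hR
            gcongr
        _ = ENNReal.ofReal (64 * A₂) * ENNReal.ofReal (1 / 2 ^ k) := by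
            rw [show (16 : ℝ≥0∞) + 2 * 16 + 16 = ENNReal.ofReal 64 by norm_num, hE,
              ← ENNReal.ofReal_mul (by positivity), ← ENNReal.ofReal_mul (by positivity)]
            congr 1; ring
        _ ≤ _ := by
            gcongr
            linarith

open SchwartzMap in
theorem SchwartzMap.exists_comp_mul (m : 𝓢(ℝ, ℂ)) {c : ℝ} (hc : c ≠ 0) :
    ∃ g : 𝓢(ℝ, ℂ), ∀ x, g x = m (c * x) :=
  ⟨compCLMOfContinuousLinearEquiv ℂ (ContinuousLinearEquiv.unitsEquivAut ℝ (Units.mk0 c hc)) m,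
    fun x => by simp [mul_comm]⟩

/-- The symbol `m₀` for `k = 0`, and the dilation of `m₁` by `2 ^ k` for `k ≥ 1`. -/
def dilSym (m₀ m₁ : ℝ → ℂ) (k : ℕ) (ξ : ℝ) : ℂ :=
  if k = 0 then m₀ ξ else m₁ (((2:ℝ)^k)⁻¹ * ξ)

theorem fourierInv_comp_inv_mul (m : ℝ → ℂ) {R : ℝ} (hR : 0 < R) (x : ℝ) :
    𝓕⁻ (fun ξ => m (R⁻¹ * ξ)) x = R * 𝓕⁻ m (R * x) := by
  rw [Real.fourierInv_eq', Real.fourierInv_eq']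
  have := Measure.integral_comp_inv_mul_left
    (fun ξ : ℝ => Complex.exp (↑(2 * π * inner ℝ ξ (R * x)) * Complex.I) • m ξ) R
  rw [abs_of_pos hR] at this
  rw [← Complex.real_smul, ← this]
  refine integral_congr_ae (Filter.Eventually.of_forall fun ξ => ?_)
  simp only [RCLike.inner_apply, conj_trivial]
  congr 5
  field_simp

open SchwartzMap in
theorem exists_schwartz_eq_dilKernel (m₀ m₁ : 𝓢(ℝ, ℂ)) (k : ℕ) :
    ∃ K : 𝓢(ℝ, ℂ), (∀ x, K x = dilKernel (𝓕⁻ ⇑m₀) (𝓕⁻ ⇑m₁) k x) ∧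
      ∀ ξ, 𝓕 K ξ = dilSym m₀ m₁ k ξ := by
  rcases eq_or_ne k 0 with rfl | hk
  · refine ⟨𝓕⁻ m₀, fun x => ?_, fun ξ => ?_⟩
    · simp [dilKernel, fourierInv_coe]
    · simp [dilSym]
  · obtain ⟨g, hg⟩ := m₁.exists_comp_mul (c := ((2:ℝ)^k)⁻¹) (by positivity)
    refine ⟨𝓕⁻ g, fun x => ?_, fun ξ => ?_⟩
    · rw [fourierInv_coe, show ⇑g = fun ξ => m₁ (((2:ℝ)^k)⁻¹ * ξ) from funext hg,
        fourierInv_comp_inv_mul _ (by positivity)]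
      simp [dilKernel, hk]
    · simp [dilSym, hk, hg]

open SchwartzMap in
theorem exists_schwartz_eq_conv (f K : 𝓢(ℝ, ℂ)) :
    ∃ F : 𝓢(ℝ, ℂ), (∀ x, F x = conv f K x) ∧ ∀ ξ, 𝓕 F ξ = 𝓕 f ξ * 𝓕 K ξ := by
  refine ⟨SchwartzMap.convolution (ContinuousLinearMap.mul ℂ ℂ) f K, fun x => ?_, fun ξ => ?_⟩
  · rw [SchwartzMap.convolution_apply]
    rfl
  · rw [SchwartzMap.fourier_convolution, SchwartzMap.pairing_apply_apply]
    rfl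

open SchwartzMap in
theorem SchwartzMap.eq_of_fourier_eq {f g : 𝓢(ℝ, ℂ)} (h : ∀ ξ, 𝓕 f ξ = 𝓕 g ξ) : f = g := by
  have : 𝓕 f = 𝓕 g := by ext ξ; exact h ξ
  have hf : 𝓕⁻ (𝓕 f) = f := FourierTransform.fourierInv_fourier_eq f
  rw [← hf, this]
  exact FourierTransform.fourierInv_fourier_eq g

open SchwartzMap in
theorem exists_fourier_primitive (m : 𝓢(ℝ, ℂ)) (hc : HasCompactSupport m) {δ : ℝ} (hδ : 0 < δ)
    (h0 : ∀ ξ, |ξ| < δ → m ξ = 0) :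
    ∃ Ψ : 𝓢(ℝ, ℂ), ∀ x, HasDerivAt Ψ (𝓕 m x) x := by
  set g : ℝ → ℂ := fun ξ => (-2 * π * Complex.I * ξ)⁻¹ * m ξ with hg
  have hgc : HasCompactSupport g := hc.mul_left
  have hgs : ContDiff ℝ (⊤ : ℕ∞) g := by
    rw [contDiff_iff_contDiffAt]
    intro ξ
    rcases eq_or_ne ξ 0 with rfl | hξ
    · have : g =ᶠ[nhds 0] fun _ => 0 := by
        filter_upwards [Metric.ball_mem_nhds (0:ℝ) hδ] with y hy
        simp only [Metric.mem_ball, dist_zero_right, Real.norm_eq_abs] at hy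
        simp [hg, h0 y hy]
      exact contDiffAt_const.congr_of_eventuallyEq this
    · refine ContDiffAt.mul (ContDiffAt.inv ?_ ?_) (m.smooth _).contDiffAt
      · exact contDiffAt_const.mul Complex.ofRealCLM.contDiff.contDiffAt
      · simp [hξ, Real.pi_ne_zero]
  set G := hgc.toSchwartzMap hgs
  have hG : ∀ ξ, G ξ = g ξ := fun ξ => rfl
  refine ⟨𝓕 G, fun x => ?_⟩
  rw [fourier_coe, fourier_coe]
  have h_int : Integrable (fun x : ℝ => x • G x) := by
    have hc' : HasCompactSupport (fun x : ℝ => x • G x) := hgc.smul_left (f := fun x : ℝ => x)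
    exact Continuous.integrable_of_hasCompactSupport (by fun_prop) hc'
  have := Real.hasDerivAt_fourier G.integrable h_int x
  refine this.congr_deriv (congrArg (fun u : ℝ → ℂ => 𝓕 u x) (funext fun ξ => ?_))
  rw [hG]
  simp only [hg, smul_eq_mul]
  rcases eq_or_ne ξ 0 with rfl | hξ
  · simp [h0 0 (by simpa using hδ)]
  · exact mul_inv_cancel_left₀ (by simp [hξ, Real.pi_ne_zero]) _

theorem integrable_haarFn (j : ℕ) (μ : ℤ) : Integrable (haarFn j μ) := by
  unfold haarFn
  refine Integrable.sub ?_ ?_ <;>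
  · rw [integrable_indicator_iff measurableSet_Ico]
    exact integrableOn_const (by simp)

theorem measurable_haarFn (j : ℕ) (μ : ℤ) : Measurable (haarFn j μ) := by
  unfold haarFn
  exact (measurable_const.indicator measurableSet_Ico).sub
    (measurable_const.indicator measurableSet_Ico)

open SchwartzMap in
/-- The pairing of `conv F K` against a Haar function, moved to the reflected kernel. -/
theorem enorm_integral_conv_mul_haarFn_le (F K : 𝓢(ℝ, ℂ)) {κ : ℝ → ℂ} (hκ : ∀ x, κ x = K (-x))
    (j : ℕ) (μ : ℤ) :
    ‖∫ y, conv F K y * haarFn j μ y‖ₑ ≤ ∫⁻ y, ‖F y‖ₑ * ‖conv (haarFn j μ) κ y‖ₑ := by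
  have e : ∫ y, conv F K y * haarFn j μ y = ∫ y, F y * conv (haarFn j μ) κ y := by
    have e1 : ∀ y, conv F K y * haarFn j μ y = ∫ t, F t * K (y - t) * haarFn j μ y := fun y => by
      rw [integral_mul_const]; rfl
    have e2 : ∀ t, F t * conv (haarFn j μ) κ t = ∫ y, F t * K (y - t) * haarFn j μ y := fun t => by
      unfold conv
      rw [← integral_const_mul]
      congr 1
      ext y
      rw [hκ, neg_sub]
      ring
    simp_rw [e1, e2]
    refine integral_integral_swap ?_
    have h1 : Integrable (fun z : ℝ × ℝ => haarFn j μ z.1 * F z.2) (volume.prod volume) :=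
      (integrable_haarFn j μ).mul_prod F.integrable
    obtain ⟨A, hA, hb⟩ := K.exists_norm_le_div_sq
    have h2 := h1.bdd_mul (f := fun z : ℝ × ℝ => K (z.1 - z.2)) (c := A)
      (by fun_prop) (Filter.Eventually.of_forall fun z => (hb _).trans (by
        apply div_le_self hA.le
        have := abs_nonneg (z.1 - z.2)
        nlinarith))
    refine h2.congr (Filter.Eventually.of_forall fun z => ?_)
    simp only [Function.uncurry]
    ring
  rw [e]
  refine (enorm_integral_le_lintegral_enorm _).trans (le_of_eq ?_)
  simp_rw [enorm_mul]

open SchwartzMap in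
theorem SchwartzMap.norm_le_integral_norm_fourier (f : 𝓢(ℝ, ℂ)) (x : ℝ) :
    ‖f x‖ ≤ ∫ ξ, ‖𝓕 f ξ‖ := by
  have hf : 𝓕⁻ (𝓕 f) = f := FourierTransform.fourierInv_fourier_eq f
  conv_lhs => rw [← hf, fourierInv_coe]
  exact VectorFourier.norm_fourierIntegral_le_integral_norm _ _ _ _ _

open SchwartzMap in
/-- A Littlewood-Paley type resolution of a Schwartz function, tested against a Haar function. -/
theorem enorm_integral_mul_haarFn_le_tsum (f : 𝓢(ℝ, ℂ)) (F : ℕ → 𝓢(ℝ, ℂ)) (σ : ℕ → ℝ → ℂ)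
    {M : ℝ} (hF : ∀ k ξ, 𝓕 (F k) ξ = 𝓕 f ξ * σ k ξ)
    (hM : ∀ n ξ, ‖∑ k ∈ Finset.range n, σ k ξ‖ ≤ M)
    (h1 : ∀ ξ, ∀ᶠ n in Filter.atTop, ∑ k ∈ Finset.range n, σ k ξ = 1) (j : ℕ) (μ : ℤ) :
    ‖∫ y, f y * haarFn j μ y‖ₑ ≤ ∑' k, ‖∫ y, F k y * haarFn j μ y‖ₑ := by
  set D : ℕ → 𝓢(ℝ, ℂ) := fun n => f - ∑ k ∈ Finset.range n, F k with hD
  have hFD : ∀ n ξ, 𝓕 (D n) ξ = 𝓕 f ξ * (1 - ∑ k ∈ Finset.range n, σ k ξ) := by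
    intro n ξ
    have : 𝓕 (D n) = 𝓕 f - ∑ k ∈ Finset.range n, 𝓕 (F k) := by
      rw [← fourierCLM_apply (R := ℂ), ← fourierCLM_apply (R := ℂ), hD, map_sub, map_sum]
      rfl
    rw [this, sub_apply, sum_apply]
    simp_rw [hF]
    rw [← Finset.mul_sum]
    ring
  have hlim : Filter.Tendsto (fun n => ∫ ξ, ‖𝓕 (D n) ξ‖) Filter.atTop (nhds 0) := by
    have := tendsto_integral_of_dominated_convergence (μ := volume)
      (F := fun n ξ => ‖𝓕 (D n) ξ‖) (f := fun _ => (0:ℝ)) (fun ξ => (1 + M) * ‖𝓕 f ξ‖)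
      (fun n => (𝓕 (D n)).continuous.norm.aestronglyMeasurable)
      ((𝓕 f).integrable.norm.const_mul _)
      (fun n => Filter.Eventually.of_forall fun ξ => by
        rw [norm_norm, hFD, norm_mul, mul_comm]
        gcongr
        refine (norm_sub_le _ _).trans ?_
        rw [norm_one]
        linarith [hM n ξ])
      (Filter.Eventually.of_forall fun ξ => by
        refine tendsto_const_nhds.congr' ?_
        filter_upwards [h1 ξ] with n hn
        rw [hFD, hn]
        simp)
    simpa using this
  have h_int : ∀ g : 𝓢(ℝ, ℂ), Integrable (fun y => g y * haarFn j μ y) := by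
    intro g
    obtain ⟨A, hA, hb⟩ := g.exists_norm_le_div_sq
    exact (integrable_haarFn j μ).bdd_mul (c := A) g.continuous.aestronglyMeasurable
      (Filter.Eventually.of_forall fun z => (hb _).trans (by
        apply div_le_self hA.le
        have := abs_nonneg z
        nlinarith))
  have hdiff : ∀ n, ∫ y, D n y * haarFn j μ y =
      (∫ y, f y * haarFn j μ y) - ∑ k ∈ Finset.range n, ∫ y, F k y * haarFn j μ y := by
    intro n
    rw [← integral_finsetSum _ (fun k _ => h_int (F k)), ← integral_sub (h_int f)
      (integrable_finsetSum _ (fun k _ => h_int (F k)))]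
    congr 1
    ext y
    rw [hD]
    simp only [sub_apply, sum_apply, sub_mul, Finset.sum_mul]
  have hD0 : Filter.Tendsto (fun n => ∫ y, D n y * haarFn j μ y) Filter.atTop (nhds 0) := by
    refine squeeze_zero_norm (a := fun n => (∫ ξ, ‖𝓕 (D n) ξ‖) * ∫ y, ‖haarFn j μ y‖) (fun n => ?_)
      (by simpa using hlim.mul_const _)
    rw [← integral_const_mul]
    refine (norm_integral_le_integral_norm _).trans (integral_mono (h_int (D n)).norm
      ((integrable_haarFn j μ).norm.const_mul _) fun y => ?_)
    simp only [norm_mul]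
    gcongr
    exact (D n).norm_le_integral_norm_fourier y
  have hsum : Filter.Tendsto (fun n => ∑ k ∈ Finset.range n, ∫ y, F k y * haarFn j μ y)
      Filter.atTop (nhds (∫ y, f y * haarFn j μ y)) := by
    have := hD0.const_sub (∫ y, f y * haarFn j μ y)
    simp_rw [hdiff] at this
    simpa using this
  refine le_of_tendsto hsum.enorm (Filter.Eventually.of_forall fun n => ?_)
  exact (enorm_sum_le _ _).trans (ENNReal.sum_le_tsum _)

open SchwartzMap in
theorem exists_fourierInv_primitive (m : 𝓢(ℝ, ℂ)) (hc : HasCompactSupport m) {δ : ℝ} (hδ : 0 < δ)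
    (h0 : ∀ ξ, |ξ| < δ → m ξ = 0) :
    ∃ Ψ : 𝓢(ℝ, ℂ), ∀ x, HasDerivAt Ψ (𝓕⁻ m x) x := by
  obtain ⟨m', hm'⟩ := m.exists_comp_mul (c := -1) (by norm_num)
  have hm'' : ⇑m' = fun x => m (-x) := funext fun x => by simpa using hm' x
  obtain ⟨Ψ, hΨ⟩ := exists_fourier_primitive m'
    (by rw [hm'']; exact hc.comp_homeomorph (Homeomorph.neg ℝ)) hδ
    (fun ξ hξ => by rw [hm'']; exact h0 _ (by simpa using hξ))
  refine ⟨Ψ, fun x => (hΨ x).congr_deriv ?_⟩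
  rw [fourier_coe, fourierInv_coe, Real.fourierInv_eq_fourier_comp_neg, hm'']

theorem HasCompactSupport.comp_mul_left {m : ℝ → ℂ} (hc : HasCompactSupport m) {c : ℝ}
    (h : c ≠ 0) : HasCompactSupport (fun ξ => m (c * ξ)) :=
  hc.comp_homeomorph (Homeomorph.mulLeft₀ c h)

open SchwartzMap in
theorem exists_LPop_structure (φ₀ : ℝ → ℂ) (hφsmooth : ContDiff ℝ (⊤ : ℕ∞) φ₀)
    (hφcpt : HasCompactSupport φ₀) (hφone : ∀ ξ : ℝ, |ξ| ≤ 4/3 → φ₀ ξ = 1)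
    (hφzero : ∀ ξ : ℝ, 3/2 ≤ |ξ| → φ₀ ξ = 0) :
    ∃ κ₀ κ₁ Ψ ν₀ ν₁ Θ : 𝓢(ℝ, ℂ), (∀ x, HasDerivAt Ψ (κ₁ x) x) ∧ (∀ x, HasDerivAt Θ (ν₁ x) x) ∧
      (∀ k g, LPop φ₀ k g = conv g (dilKernel κ₀ κ₁ k)) ∧
      (∀ (f : 𝓢(ℝ, ℂ)) k, Continuous (LPop φ₀ k f)) ∧
      (∀ (f : 𝓢(ℝ, ℂ)) k j μ, ‖∫ y, LPop φ₀ k f y * haarFn j μ y‖ₑ ≤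
        ∫⁻ y, ‖LPop φ₀ k f y‖ₑ * ‖conv (haarFn j μ) (dilKernel ν₀ ν₁ k) y‖ₑ) ∧
      (∀ (f : 𝓢(ℝ, ℂ)) j μ, ‖∫ y, f y * haarFn j μ y‖ₑ ≤
        ∑' k, ‖∫ y, LPop φ₀ k f y * haarFn j μ y‖ₑ) := by
  set m₀ : 𝓢(ℝ, ℂ) := hφcpt.toSchwartzMap hφsmooth with hm₀'
  have hm₀ : ∀ ξ, m₀ ξ = φ₀ ξ := fun ξ => rfl
  obtain ⟨g₂, hg₂⟩ := m₀.exists_comp_mul (c := 2) (by norm_num)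
  obtain ⟨g₄, hg₄⟩ := m₀.exists_comp_mul (c := 4) (by norm_num)
  obtain ⟨l₀, hl₀⟩ := m₀.exists_comp_mul (c := 1/2) (by norm_num)
  set m₁ := m₀ - g₂ with hm₁'
  have hm₁ : ∀ ξ, m₁ ξ = φ₀ ξ - φ₀ (2 * ξ) := fun ξ => by
    rw [hm₁', sub_apply, hg₂, hm₀, hm₀]
  set l₁ := l₀ - g₄ with hl₁'
  have hl₁ : ∀ ξ, l₁ ξ = φ₀ (1 / 2 * ξ) - φ₀ (4 * ξ) := fun ξ => by
    rw [hl₁', sub_apply, hg₄, hl₀, hm₀, hm₀]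
  have hm₁e : ⇑m₁ = fun ξ => φ₀ ξ - φ₀ (2 * ξ) := funext hm₁
  have hl₁e : ⇑l₁ = fun ξ => φ₀ (1 / 2 * ξ) - φ₀ (4 * ξ) := funext hl₁
  obtain ⟨Ψ, hΨ⟩ := exists_fourierInv_primitive m₁
    (by rw [hm₁e]; exact hφcpt.sub (hφcpt.comp_mul_left (by norm_num))) (δ := 2/3) (by norm_num)
    (fun ξ hξ => by
      rw [hm₁, hφone _ (by linarith), hφone _ (by rw [abs_mul]; norm_num; linarith), sub_self])
  obtain ⟨Θ, hΘ⟩ := exists_fourier_primitive l₁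
    (by rw [hl₁e]
        exact (hφcpt.comp_mul_left (by norm_num)).sub (hφcpt.comp_mul_left (by norm_num)))
    (δ := 1/3) (by norm_num)
    (fun ξ hξ => by
      rw [hl₁, hφone _ (by rw [abs_mul]; norm_num; linarith),
        hφone _ (by rw [abs_mul]; norm_num; linarith), sub_self])
  have hLP : ∀ k g, LPop φ₀ k g = conv g (dilKernel (𝓕⁻ m₀ : 𝓢(ℝ, ℂ)) (𝓕⁻ m₁ : 𝓢(ℝ, ℂ)) k) := by
    intro k g
    unfold LPop
    rw [fourierInv_coe, fourierInv_coe, hm₁e]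
    rcases eq_or_ne k 0 with rfl | hk
    · simp only [if_true]
      rfl
    · simp only [hk, if_false]
      congr 1
      ext x
      simp [dilKernel, hk]
  choose K hK hKF using exists_schwartz_eq_dilKernel m₀ m₁
  choose Λ hΛ hΛF using exists_schwartz_eq_dilKernel l₀ l₁
  have hF : ∀ (f : 𝓢(ℝ, ℂ)) k, ∃ F : 𝓢(ℝ, ℂ), (∀ x, F x = LPop φ₀ k f x) ∧
      ∀ ξ, 𝓕 F ξ = 𝓕 f ξ * dilSym m₀ m₁ k ξ := by
    intro f k
    obtain ⟨F, hF, hFF⟩ := exists_schwartz_eq_conv f (K k)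
    refine ⟨F, fun x => ?_, fun ξ => by rw [hFF, hKF]⟩
    rw [hF, hLP]
    congr 1
    ext y
    rw [hK, fourierInv_coe, fourierInv_coe]
  choose F hFx hFF using hF
  have hFe : ∀ f k, ⇑(F f k) = LPop φ₀ k f := fun f k => funext (hFx f k)
  have hprod : ∀ k ξ, dilSym m₀ m₁ k ξ * dilSym l₀ l₁ k ξ = dilSym m₀ m₁ k ξ := by
    have h0 : ∀ ξ, m₀ ξ * l₀ ξ = m₀ ξ := fun ξ => by
      rcases le_total (3/2) |ξ| with h | h
      · rw [hm₀, hφzero ξ h, zero_mul]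
      · rw [hl₀, hm₀ (1 / 2 * ξ), hφone _ (by rw [abs_mul]; norm_num; linarith), mul_one]
    have h1 : ∀ ξ, m₁ ξ * l₁ ξ = m₁ ξ := fun ξ => by
      rw [hm₁, hl₁]
      rcases le_total (3/2) |ξ| with h | h
      · rw [hφzero ξ h, hφzero (2 * ξ) (by rw [abs_mul]; norm_num; linarith)]
        simp
      · rcases le_total |ξ| (2/3) with h' | h'
        · rw [hφone _ (by linarith), hφone (2 * ξ) (by rw [abs_mul]; norm_num; linarith)]
          simp
        · rw [hφone (1 / 2 * ξ) (by rw [abs_mul]; norm_num; linarith),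
            hφzero (4 * ξ) (by rw [abs_mul]; norm_num; linarith)]
          simp
    intro k ξ
    unfold dilSym
    split_ifs
    · exact h0 ξ
    · exact h1 _
  have hrepr : ∀ f k x, F f k x = conv (F f k) (Λ k) x := by
    intro f k x
    obtain ⟨G, hG, hGF⟩ := exists_schwartz_eq_conv (F f k) (Λ k)
    rw [← hG, SchwartzMap.eq_of_fourier_eq (f := F f k) (g := G)]
    intro ξ
    rw [hGF, hFF, hΛF, mul_assoc, hprod]
  refine ⟨𝓕⁻ m₀, 𝓕⁻ m₁, Ψ, 𝓕 l₀, 𝓕 l₁, Θ, hΨ, hΘ, hLP, fun f k => ?_, fun f k j μ => ?_,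
    fun f j μ => ?_⟩
  · rw [← hFe]
    exact (F f k).continuous
  · have := enorm_integral_conv_mul_haarFn_le (F f k) (Λ k) 
      (κ := dilKernel (𝓕 l₀ : 𝓢(ℝ, ℂ)) (𝓕 l₁ : 𝓢(ℝ, ℂ)) k)
      (fun x => by
        rw [hΛ, fourier_coe, fourier_coe]
        unfold dilKernel
        rw [Real.fourierInv_eq_fourier_neg, Real.fourierInv_eq_fourier_neg, mul_neg, neg_neg,
          neg_neg]) j μ
    simp_rw [← hrepr, hFe] at this
    exact this
  · have htel : ∀ n ξ, ∑ k ∈ Finset.range (n + 1), dilSym m₀ m₁ k ξ = φ₀ (((2:ℝ)^n)⁻¹ * ξ) := by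
      intro n ξ
      induction n with
      | zero => simp [dilSym, hm₀]
      | succ n ih =>
        rw [Finset.sum_range_succ, ih]
        simp only [dilSym, Nat.add_eq_zero_iff, one_ne_zero, and_false, if_false, hm₁]
        rw [show 2 * (((2:ℝ) ^ (n + 1))⁻¹ * ξ) = ((2:ℝ)^n)⁻¹ * ξ by field_simp; ring]
        ring
    obtain ⟨M, hM0, hM⟩ := m₀.exists_norm_le_div_sq
    have hM' : ∀ ξ, ‖φ₀ ξ‖ ≤ M := fun ξ => by
      rw [← hm₀]
      refine (hM ξ).trans (div_le_self hM0.le ?_)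
      have := abs_nonneg ξ
      nlinarith
    have := enorm_integral_mul_haarFn_le_tsum f (F f) (dilSym m₀ m₁) (M := M) (hFF f)
      (fun n ξ => by
        cases n with
        | zero => simpa using hM0.le
        | succ n => rw [htel]; exact hM' _)
      (fun ξ => by
        obtain ⟨n₀, hn₀⟩ := pow_unbounded_of_one_lt |ξ| (one_lt_two (α := ℝ))
        filter_upwards [Filter.eventually_ge_atTop (n₀ + 1)] with n hn
        obtain ⟨n, rfl⟩ : ∃ k, n = k + 1 := ⟨n - 1, by omega⟩
        rw [htel]
        apply hφone
        rw [abs_mul, abs_of_pos (by positivity), inv_mul_le_iff₀ (by positivity)]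
        have : (2:ℝ) ^ n₀ ≤ 2 ^ n := pow_le_pow_right₀ one_le_two (by omega)
        have h2 : (0:ℝ) < 2 ^ n := by positivity
        linarith) j μ
    simp_rw [hFe] at this
    exact this

theorem etaKernel_neg (R u : ℝ) : etaKernel R (-u) = etaKernel R u := by
  simp [etaKernel]

theorem kernelAvg_etaKernel_eq (R : ℝ) (G : ℝ → ℝ≥0∞) (y : ℝ) :
    kernelAvg (etaKernel R) G y = ∫⁻ z, etaKernel R (z - y) * G z := by
  unfold kernelAvg
  refine lintegral_congr fun z => ?_
  rw [← etaKernel_neg, neg_sub]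

/-- Weighted Hölder bound for the pairing of `u` with a weight dominated by a dilated kernel. -/
theorem lintegral_mul_rpow_le_kernelAvg {u w : ℝ → ℝ≥0∞} (hu : Measurable u) (hw : Measurable w)
    {r : ℝ} (hr : 1 ≤ r) {c₁ c₂ : ℝ≥0∞} {R y : ℝ}
    (h₁ : ∀ z, w z ≤ c₁ * etaKernel R (z - y)) (h₂ : ∫⁻ z, w z ≤ c₂) :
    (∫⁻ z, u z * w z) ^ r ≤
      c₂ ^ (r - 1) * c₁ * kernelAvg (etaKernel R) (fun z => u z ^ r) y := by
  have h := lintegral_mul_rpow_le (μ := volume) hw hu hr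
  simp_rw [mul_comm (u _)]
  refine h.trans ?_
  rw [mul_assoc]
  refine mul_le_mul' (ENNReal.rpow_le_rpow h₂ (by linarith)) ?_
  rw [kernelAvg_etaKernel_eq, ← lintegral_const_mul]
  · refine lintegral_mono fun z => ?_
    rw [← mul_assoc]
    gcongr
    exact h₁ z
  · exact (((measurable_etaKernel R).comp (measurable_id.sub_const y))).mul (hu.pow_const r)

theorem two_rpow_add (a b : ℝ) : (2:ℝ≥0∞) ^ (a + b) = 2 ^ a * 2 ^ b :=
  ENNReal.rpow_add _ _ (by norm_num) (by norm_num)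

theorem ofReal_two_rpow (a : ℝ) : ENNReal.ofReal ((2:ℝ) ^ a) = (2:ℝ≥0∞) ^ a := by
  rw [← ENNReal.ofReal_rpow_of_pos (by norm_num)]
  norm_num

theorem ofReal_two_pow_div_sq (k j : ℕ) :
    ENNReal.ofReal ((2:ℝ) ^ k / (2 ^ j) ^ 2) = (2:ℝ≥0∞) ^ ((k:ℝ) - 2 * j) := by
  rw [← ofReal_two_rpow, Real.rpow_sub (by norm_num), Real.rpow_natCast, mul_comm (2:ℝ) (j:ℝ),
    Real.rpow_mul (by norm_num), Real.rpow_natCast, Real.rpow_two]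

theorem ofReal_one_div_two_pow (j : ℕ) :
    ENNReal.ofReal ((1:ℝ) / 2 ^ j) = (2:ℝ≥0∞) ^ (-(j:ℝ)) := by
  rw [← ofReal_two_rpow, Real.rpow_neg (by norm_num), Real.rpow_natCast, one_div]

theorem two_mul_rpow_le_kernelAvg {u w : ℝ → ℝ≥0∞} (hu : Measurable u) (hw : Measurable w)
    {r C : ℝ} (hr : 1 ≤ r) {l j : ℕ} {y : ℝ}
    (h₁ : l ≤ j → ∀ z, w z ≤ ENNReal.ofReal C * ENNReal.ofReal (2 ^ l / (2 ^ j) ^ 2) *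
      etaKernel (2 ^ l) (z - y))
    (h₂ : j ≤ l → ∀ z, w z ≤ ENNReal.ofReal C * ENNReal.ofReal (1 / 2 ^ j) *
      etaKernel (2 ^ j) (z - y))
    (h₃ : j ≤ l → ∫⁻ z, w z ≤ ENNReal.ofReal C * ENNReal.ofReal (1 / 2 ^ l)) :
    (2 ^ j * ∫⁻ z, u z * w z) ^ r ≤
      (16 * ENNReal.ofReal C) ^ r *
        2 ^ (r * min ((l:ℝ) - j) (-(1 - 1 / r) * ((l:ℝ) - j))) *
        kernelAvg (etaKernel (2 ^ min j l)) (fun z => u z ^ r) y := by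
  have hr0 : 0 < r := by linarith
  set c := ENNReal.ofReal C
  have hc : c ≤ 16 * c := le_mul_of_one_le_left zero_le (by norm_num)
  have hcr : (16 * c) ^ r = (16 * c) ^ (r - 1) * (16 * c) := by
    have := ENNReal.rpow_add_of_nonneg (x := 16 * c) (r - 1) 1 (by linarith) (by norm_num)
    rwa [sub_add_cancel, ENNReal.rpow_one] at this
  have h2j : ((2:ℝ≥0∞) ^ j) ^ r = 2 ^ ((j:ℝ) * r) := by
    rw [ENNReal.rpow_mul, ENNReal.rpow_natCast]
  rw [ENNReal.mul_rpow_of_nonneg _ _ hr0.le, h2j]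
  rcases le_total l j with hlj | hjl
  · have hlj' : (l:ℝ) - j ≤ 0 := sub_nonpos.mpr (by exact_mod_cast hlj)
    have hmin : min ((l:ℝ) - j) (-(1 - 1 / r) * ((l:ℝ) - j)) = (l:ℝ) - j := by
      apply min_eq_left
      have : 0 ≤ 1 - 1 / r := sub_nonneg.mpr ((div_le_one hr0).mpr hr)
      nlinarith
    rw [hmin, min_eq_right hlj]
    have hw2 : ∫⁻ z, w z ≤ c * 2 ^ ((l:ℝ) - 2 * j) * 16 := by
      refine (lintegral_mono (h₁ hlj)).trans ?_
      have hm : Measurable fun z => etaKernel (2 ^ l) (z - y) :=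
        (measurable_etaKernel _).comp (measurable_id.sub_const y)
      rw [lintegral_const_mul _ hm, ofReal_two_pow_div_sq]
      gcongr
      rw [lintegral_sub_right_eq_self]
      exact lintegral_etaKernel_le (by positivity)
    have h := lintegral_mul_rpow_le_kernelAvg hu hw hr (h₁ hlj) hw2
    rw [ofReal_two_pow_div_sq] at h
    refine (mul_le_mul_right h _).trans ?_
    rw [← mul_assoc]
    refine mul_le_mul_left ?_ _
    calc (2:ℝ≥0∞) ^ ((j:ℝ) * r) * ((c * 2 ^ ((l:ℝ) - 2 * j) * 16) ^ (r - 1) *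
          (c * 2 ^ ((l:ℝ) - 2 * j)))
        = (16 * c) ^ (r - 1) * c * ((2:ℝ≥0∞) ^ ((j:ℝ) * r) *
          (2 ^ (((l:ℝ) - 2 * j) * (r - 1)) * 2 ^ ((l:ℝ) - 2 * j))) := by
          rw [show c * 2 ^ ((l:ℝ) - 2 * j) * 16 = (16 * c) * 2 ^ ((l:ℝ) - 2 * j) by ring,
            ENNReal.mul_rpow_of_nonneg _ _ (by linarith : (0:ℝ) ≤ r - 1), ← ENNReal.rpow_mul]
          ring
      _ ≤ (16 * c) ^ r * 2 ^ (r * ((l:ℝ) - j)) := by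
          rw [← two_rpow_add, ← two_rpow_add, hcr]
          refine mul_le_mul' (mul_le_mul_right hc _) (le_of_eq ?_)
          congr 1
          ring
  · have hlj' : 0 ≤ (l:ℝ) - j := sub_nonneg.mpr (by exact_mod_cast hjl)
    have hmin : min ((l:ℝ) - j) (-(1 - 1 / r) * ((l:ℝ) - j)) = -(1 - 1 / r) * ((l:ℝ) - j) := by
      apply min_eq_right
      have : 0 ≤ 1 - 1 / r := sub_nonneg.mpr ((div_le_one hr0).mpr hr)
      nlinarith
    rw [hmin, min_eq_left hjl]
    have h := lintegral_mul_rpow_le_kernelAvg hu hw hr (h₂ hjl) (h₃ hjl)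
    rw [ofReal_one_div_two_pow, ofReal_one_div_two_pow] at h
    refine (mul_le_mul_right h _).trans ?_
    rw [← mul_assoc]
    refine mul_le_mul_left ?_ _
    calc (2:ℝ≥0∞) ^ ((j:ℝ) * r) * ((c * 2 ^ (-(l:ℝ))) ^ (r - 1) * (c * 2 ^ (-(j:ℝ))))
        = c ^ (r - 1) * c * ((2:ℝ≥0∞) ^ ((j:ℝ) * r) *
          (2 ^ ((-(l:ℝ)) * (r - 1)) * 2 ^ (-(j:ℝ)))) := by
          rw [ENNReal.mul_rpow_of_nonneg _ _ (by linarith : (0:ℝ) ≤ r - 1), ← ENNReal.rpow_mul]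
          ring
      _ ≤ (16 * c) ^ r * 2 ^ (r * (-(1 - 1 / r) * ((l:ℝ) - j))) := by
          rw [← two_rpow_add, ← two_rpow_add, hcr]
          refine mul_le_mul' (mul_le_mul' (ENNReal.rpow_le_rpow hc (by linarith)) hc) (le_of_eq ?_)
          congr 1
          field_simp
          ring

theorem volume_haarIco (j : ℕ) (μ : ℤ) : volume (haarIco j μ) = 2 ^ (-(j:ℝ)) := by
  rw [haarIco, Real.volume_Ico, ← ofReal_one_div_two_pow]
  congr 1
  rw [zpow_neg, zpow_natCast]
  ring

theorem measurableSet_haarIco (j : ℕ) (μ : ℤ) : MeasurableSet (haarIco j μ) := measurableSet_Ico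

theorem haarIco_pairwise_disjoint (j : ℕ) {μ ν : ℤ} (h : μ ≠ ν) :
    Disjoint (haarIco j μ) (haarIco j ν) := by
  have key : ∀ {a b : ℤ}, a < b → Disjoint (haarIco j a) (haarIco j b) := by
    intro a b hab
    rw [Set.disjoint_left]
    intro x hx hx'
    have h1 := hx.2
    have h2 := hx'.1
    have h3 : (a:ℝ) + 1 ≤ b := by exact_mod_cast hab
    have h4 : (2:ℝ)^(-(j:ℤ)) * (a + 1) ≤ (2:ℝ)^(-(j:ℤ)) * b := by gcongr
    linarith
  rcases lt_or_gt_of_ne h with h | h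
  · exact key h
  · exact (key h).symm

/-- A pointwise bound by a kernel at every point of `haarIco j μ` can be averaged. -/
theorem le_setLIntegral_haarIco {v : ℝ≥0∞} {G : ℝ → ℝ≥0∞} {j : ℕ} {μ : ℤ} {c : ℝ≥0∞}
    (hG : Measurable G) (h : ∀ y ∈ haarIco j μ, v ≤ c * G y) :
    v ≤ 2 ^ (j:ℝ) * c * ∫⁻ y in haarIco j μ, G y := by
  have h1 : ∫⁻ _ in haarIco j μ, v ≤ ∫⁻ y in haarIco j μ, c * G y :=
    setLIntegral_mono' (measurableSet_haarIco j μ) h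
  rw [lintegral_const, Measure.restrict_apply_univ, volume_haarIco, lintegral_const_mul _ hG] at h1
  have h2 := mul_le_mul_right h1 ((2:ℝ≥0∞) ^ (j:ℝ))
  rw [mul_comm v, ← mul_assoc, ← two_rpow_add, add_neg_cancel, ENNReal.rpow_zero, one_mul] at h2
  rwa [mul_assoc]

theorem le_setLIntegral_etaKernel {v : ℝ≥0∞} {C : ℝ} {k j : ℕ} {μ : ℤ} {x : ℝ}
    (h₁ : k ≤ j → ∀ y ∈ haarIco j μ, v ≤ ENNReal.ofReal C * ENNReal.ofReal (2 ^ k / (2 ^ j) ^ 2) *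
      etaKernel (2 ^ k) (x - y))
    (h₂ : j ≤ k → ∀ y ∈ haarIco j μ, v ≤ ENNReal.ofReal C * ENNReal.ofReal (1 / 2 ^ j) *
      etaKernel (2 ^ j) (x - y)) :
    v ≤ ENNReal.ofReal C * 2 ^ (min ((k:ℝ) - j) 0) *
      ∫⁻ y in haarIco j μ, etaKernel (2 ^ min k j) (x - y) := by
  have hm : ∀ R : ℝ, Measurable fun y => etaKernel R (x - y) := fun R =>
    (measurable_etaKernel R).comp (measurable_const.sub measurable_id)
  rcases le_total k j with hkj | hjk
  · refine (le_setLIntegral_haarIco (hm _) (h₁ hkj)).trans (le_of_eq ?_)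
    have hkj' : (k:ℝ) - j ≤ 0 := sub_nonpos.mpr (by exact_mod_cast hkj)
    rw [min_eq_left hkj', min_eq_left hkj, ofReal_two_pow_div_sq, mul_left_comm, ← two_rpow_add]
    congr 3
    ring
  · refine (le_setLIntegral_haarIco (hm _) (h₂ hjk)).trans (le_of_eq ?_)
    have hkj' : 0 ≤ (k:ℝ) - j := sub_nonneg.mpr (by exact_mod_cast hjk)
    rw [min_eq_right hkj', min_eq_right hjk, ofReal_one_div_two_pow, mul_left_comm,
      ← two_rpow_add]
    congr 3
    ring

theorem sum_mul_setLIntegral_haarIco_le {a : ℤ → ℝ≥0∞} {B : ℝ → ℝ≥0∞} {j : ℕ}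
    {S : Finset ℤ} (hB : ∀ μ ∈ S, ∀ y ∈ haarIco j μ, a μ ≤ B y)
    {R : ℝ} (x : ℝ) :
    ∑ μ ∈ S, a μ * ∫⁻ y in haarIco j μ, etaKernel R (x - y) ≤ kernelAvg (etaKernel R) B x := by
  have hm : Measurable fun y => etaKernel R (x - y) :=
    (measurable_etaKernel R).comp (measurable_const.sub measurable_id)
  calc ∑ μ ∈ S, a μ * ∫⁻ y in haarIco j μ, etaKernel R (x - y)
      ≤ ∑ μ ∈ S, ∫⁻ y in haarIco j μ, etaKernel R (x - y) * B y := by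
        refine Finset.sum_le_sum fun μ hμ => ?_
        rw [← lintegral_const_mul _ hm]
        refine setLIntegral_mono' (measurableSet_haarIco j μ) fun y hy => ?_
        rw [mul_comm]
        exact mul_le_mul_right (hB μ hμ y hy) _
    _ = ∫⁻ y in ⋃ μ ∈ S, haarIco j μ, etaKernel R (x - y) * B y := by
        rw [lintegral_biUnion_finset (fun μ _ ν _ h => haarIco_pairwise_disjoint j h)
          (fun μ _ => measurableSet_haarIco j μ)]
    _ ≤ kernelAvg (etaKernel R) B x := setLIntegral_le_lintegral _ _

theorem measurable_conv_haarFn (j : ℕ) (μ : ℤ) {κ : ℝ → ℂ} (hκ : Measurable κ) :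
    Measurable (conv (haarFn j μ) κ) := by
  have h : Measurable (Function.uncurry fun x t : ℝ => haarFn j μ t * κ (x - t)) :=
    ((measurable_haarFn j μ).comp measurable_snd).mul
      (hκ.comp (measurable_fst.sub measurable_snd))
  exact (h.stronglyMeasurable.integral_prod_right (ν := volume)).measurable

theorem measurable_dilKernel {κ₀ κ₁ : ℝ → ℂ} (h₀ : Measurable κ₀) (h₁ : Measurable κ₁) (k : ℕ) :
    Measurable (dilKernel κ₀ κ₁ k) := by
  unfold dilKernel
  split_ifs
  · exact h₀
  · exact (h₁.comp (measurable_const_mul _)).const_mul _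

/-- The basic pointwise estimate for the contribution of one Haar frequency `j`. -/
theorem rpow_sum_haar_le {u : ℝ → ℝ≥0∞} {w v : ℤ → ℝ → ℝ≥0∞} (hu : Measurable u)
    (hw : ∀ μ, Measurable (w μ)) {r C C' : ℝ} (hr : 1 ≤ r) {k j l : ℕ}
    (hw₁ : ∀ μ z y, y ∈ haarIco j μ → l ≤ j → w μ z ≤
      ENNReal.ofReal C * ENNReal.ofReal (2 ^ l / (2 ^ j) ^ 2) * etaKernel (2 ^ l) (z - y))
    (hw₂ : ∀ μ z y, y ∈ haarIco j μ → j ≤ l → w μ z ≤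
      ENNReal.ofReal C * ENNReal.ofReal (1 / 2 ^ j) * etaKernel (2 ^ j) (z - y))
    (hw₃ : ∀ μ, j ≤ l → ∫⁻ z, w μ z ≤ ENNReal.ofReal C * ENNReal.ofReal (1 / 2 ^ l))
    (hv₁ : ∀ μ z y, y ∈ haarIco j μ → k ≤ j → v μ z ≤
      ENNReal.ofReal C' * ENNReal.ofReal (2 ^ k / (2 ^ j) ^ 2) * etaKernel (2 ^ k) (z - y))
    (hv₂ : ∀ μ z y, y ∈ haarIco j μ → j ≤ k → v μ z ≤
      ENNReal.ofReal C' * ENNReal.ofReal (1 / 2 ^ j) * etaKernel (2 ^ j) (z - y))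
    (S : Finset ℤ) (x : ℝ) :
    (∑ μ ∈ S, (2 ^ j * ∫⁻ z, u z * w μ z) * v μ x) ^ r ≤
      ((16 * ENNReal.ofReal C') ^ r * (16 * ENNReal.ofReal C) ^ r) *
      (2 ^ (r * min ((k:ℝ) - j) 0) * 2 ^ (r * min ((l:ℝ) - j) (-(1 - 1 / r) * ((l:ℝ) - j)))) *
      kernelAvg (etaKernel (2 ^ min k j))
        (kernelAvg (etaKernel (2 ^ min j l)) (fun z => u z ^ r)) x := by
  have hr0 : 0 < r := by linarith
  set c := ENNReal.ofReal C
  set c' := ENNReal.ofReal C'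
  set η := etaKernel (2 ^ min k j)
  set A := kernelAvg (etaKernel (2 ^ min j l)) (fun z => u z ^ r)
  set d := (16 * c) ^ r * 2 ^ (r * min ((l:ℝ) - j) (-(1 - 1 / r) * ((l:ℝ) - j)))
  have hη : Measurable η := measurable_etaKernel _
  have hA : Measurable A := measurable_kernelAvg (measurable_etaKernel _) (hu.pow_const r)
  set B : ℝ → ℝ≥0∞ := fun y => (d * A y) ^ (1 / r) with hBdef
  have hBm : Measurable B := (hA.const_mul d).pow_const _
  have hBr : ∀ y, B y ^ r = d * A y := fun y => by
    rw [hBdef, ← ENNReal.rpow_mul, one_div, inv_mul_cancel₀ hr0.ne', ENNReal.rpow_one]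
  have hB : ∀ μ ∈ S, ∀ y ∈ haarIco j μ, (2 ^ j * ∫⁻ z, u z * w μ z) ≤ B y := by
    intro μ _ y hy
    rw [← ENNReal.rpow_le_rpow_iff hr0, hBr]
    exact two_mul_rpow_le_kernelAvg hu (hw μ) hr (fun h z => hw₁ μ z y hy h)
      (fun h z => hw₂ μ z y hy h) (hw₃ μ)
  have hsum : ∑ μ ∈ S, (2 ^ j * ∫⁻ z, u z * w μ z) * v μ x ≤
      c' * 2 ^ (min ((k:ℝ) - j) 0) * kernelAvg η B x := by
    refine le_trans ?_ (mul_le_mul_right (sum_mul_setLIntegral_haarIco_le hB x) _)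
    rw [Finset.mul_sum]
    refine Finset.sum_le_sum fun μ _ => ?_
    rw [mul_left_comm]
    exact mul_le_mul_right (le_setLIntegral_etaKernel (fun h y hy => hv₁ μ x y hy h)
      (fun h y hy => hv₂ μ x y hy h)) _
  have h_int : ∫⁻ z, η z ≤ 16 := lintegral_etaKernel_le (by positivity)
  calc (∑ μ ∈ S, (2 ^ j * ∫⁻ z, u z * w μ z) * v μ x) ^ r
      ≤ (c' * 2 ^ (min ((k:ℝ) - j) 0) * kernelAvg η B x) ^ r := ENNReal.rpow_le_rpow hsum hr0.le
    _ = c' ^ r * 2 ^ (r * min ((k:ℝ) - j) 0) * kernelAvg η B x ^ r := by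
        rw [ENNReal.mul_rpow_of_nonneg _ _ hr0.le, ENNReal.mul_rpow_of_nonneg _ _ hr0.le,
          ← ENNReal.rpow_mul, mul_comm r]
    _ ≤ c' ^ r * 2 ^ (r * min ((k:ℝ) - j) 0) * (16 ^ r * kernelAvg η (fun y => d * A y) x) := by
        gcongr
        refine (kernelAvg_rpow_le hη hBm hr x).trans ?_
        simp_rw [hBr]
        gcongr
        exact (ENNReal.rpow_le_rpow h_int (by linarith)).trans
          (ENNReal.rpow_le_rpow_of_exponent_le (by norm_num) (by linarith))
    _ = _ := by
        rw [kernelAvg_const_mul hη hA, ENNReal.mul_rpow_of_nonneg _ c' hr0.le]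
        simp only [d]
        ring

/-- The sequence `g` shifted by `b`, extended by zero. -/
def shiftSeq (b : ℤ) (g : ℕ → ℝ≥0∞) (j : ℕ) : ℝ≥0∞ :=
  if 0 ≤ (j:ℤ) + b then g ((j:ℤ) + b).toNat else 0

theorem tsum_shiftSeq_le (b : ℤ) (g : ℕ → ℝ≥0∞) : ∑' j, shiftSeq b g j ≤ ∑' l, g l := by
  set S : Set ℕ := {j | 0 ≤ (j:ℤ) + b}
  have h : Function.support (shiftSeq b g) ⊆ S := by
    intro j hj
    by_contra hS
    exact hj (if_neg hS)
  rw [← tsum_subtype_eq_of_support_subset h]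
  have h2 : ∀ j : S, shiftSeq b g j = g (((j:ℕ):ℤ) + b).toNat := fun j => if_pos j.2
  simp_rw [h2]
  refine ENNReal.tsum_comp_le_tsum_of_injective (f := fun j : S => (((j:ℕ):ℤ) + b).toNat) ?_ g
  intro i j hij
  have hi : 0 ≤ ((i:ℕ):ℤ) + b := i.2
  have hj : 0 ≤ ((j:ℕ):ℤ) + b := j.2
  simp only at hij
  apply Subtype.ext
  omega

/-- The array `t` restricted to `k = j + a` and `l = j + b`, extended by zero. -/
def diagSeq (t : ℕ → ℕ → ℕ → ℝ≥0∞) (a b : ℤ) (j : ℕ) : ℝ≥0∞ :=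
  if 0 ≤ (j:ℤ) + a ∧ 0 ≤ (j:ℤ) + b then t ((j:ℤ) + a).toNat j ((j:ℤ) + b).toNat else 0

theorem rpow_tsum_tsum_le_tsum {ι : Type*} [Countable ι] (g : ι → ℕ → ℝ≥0∞) {q : ℝ} (hq : 1 ≤ q) :
    (∑' k, (∑' i, g i k) ^ q) ^ (1 / q) ≤ ∑' i, (∑' k, g i k ^ q) ^ (1 / q) := by
  have h := lintegral_rpow_tsum_le (μ := (Measure.count : Measure ℕ)) (f := g)
    (fun i => measurable_from_nat) hq
  simpa only [lintegral_count] using h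

theorem rpow_tsum_le_tsum_diagSeq (t : ℕ → ℕ → ℕ → ℝ≥0∞) {q : ℝ} (hq : 1 ≤ q) :
    (∑' k, (∑' j, ∑' l, t k j l) ^ q) ^ (1 / q) ≤
      ∑' ab : ℤ × ℤ, (∑' j, diagSeq t ab.1 ab.2 j ^ q) ^ (1 / q) := by
  have hq0 : 0 < q := by linarith
  set g : ℤ × ℤ → ℕ → ℝ≥0∞ := fun ab => shiftSeq (-ab.1) (diagSeq t ab.1 ab.2) with hg
  have h1 : ∀ k, ∑' j, ∑' l, t k j l ≤ ∑' ab, g ab k := by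
    intro k
    rw [← ENNReal.tsum_prod]
    have : ∀ jl : ℕ × ℕ, t k jl.1 jl.2 = g ((k:ℤ) - jl.1, (jl.2:ℤ) - jl.1) k := by
      intro jl
      have e1 : (k:ℤ) + -((k:ℤ) - jl.1) = jl.1 := by ring
      have e2 : (jl.1:ℤ) + ((k:ℤ) - jl.1) = k := by ring
      have e3 : (jl.1:ℤ) + ((jl.2:ℤ) - jl.1) = jl.2 := by ring
      simp only [hg, shiftSeq, diagSeq, e1, Int.toNat_natCast, e2, e3, Int.natCast_nonneg,
        and_self, if_true]
    simp_rw [this]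
    refine ENNReal.tsum_comp_le_tsum_of_injective
      (f := fun jl : ℕ × ℕ => ((k:ℤ) - jl.1, (jl.2:ℤ) - jl.1)) ?_ (fun ab => g ab k)
    intro x y hxy
    simp only [Prod.mk.injEq] at hxy
    ext <;> omega
  calc (∑' k, (∑' j, ∑' l, t k j l) ^ q) ^ (1 / q)
      ≤ (∑' k, (∑' ab, g ab k) ^ q) ^ (1 / q) := by
        gcongr with k
        exact h1 k
    _ ≤ ∑' ab, (∑' k, g ab k ^ q) ^ (1 / q) := rpow_tsum_tsum_le_tsum g hq
    _ ≤ _ := by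
        refine ENNReal.tsum_le_tsum fun ab => ENNReal.rpow_le_rpow ?_ (by positivity)
        refine le_trans (le_of_eq ?_) (tsum_shiftSeq_le (-ab.1) (fun j => diagSeq t ab.1 ab.2 j ^ q))
        congr 1
        ext k
        simp only [hg, shiftSeq]
        split_ifs
        · rfl
        · exact ENNReal.zero_rpow_of_pos hq0

theorem lintegral_rpow_tsum_le_tsum_diagSeq {T : ℕ → ℕ → ℕ → ℝ → ℝ≥0∞}
    (hT : ∀ k j l, Measurable (T k j l)) {p q : ℝ} (hq : 1 ≤ q) (hqp : q ≤ p) :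
    (∫⁻ x, (∑' k, (∑' j, ∑' l, T k j l x) ^ q) ^ (p / q)) ^ (1 / p) ≤
      ∑' ab : ℤ × ℤ, (∫⁻ x, (∑' j, diagSeq (fun k j l => T k j l x) ab.1 ab.2 j ^ q) ^ (p / q)) ^
        (1 / p) := by
  have hq0 : 0 < q := by linarith
  have hpq : ∀ y : ℝ≥0∞, y ^ (p / q) = (y ^ (1 / q)) ^ p := fun y => by
    rw [← ENNReal.rpow_mul]
    congr 1
    ring
  have hm : ∀ ab : ℤ × ℤ, Measurable fun x =>
      (∑' j, diagSeq (fun k j l => T k j l x) ab.1 ab.2 j ^ q) ^ (1 / q) := by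
    intro ab
    refine Measurable.pow_const (Measurable.tsum fun j => Measurable.pow_const ?_ _) _
    unfold diagSeq
    split_ifs
    · exact hT _ _ _
    · exact measurable_const
  simp_rw [hpq]
  refine le_trans ?_ (lintegral_rpow_tsum_le (μ := volume) hm (by linarith : 1 ≤ p))
  have hp0 : 0 < p := by linarith
  exact ENNReal.rpow_le_rpow (lintegral_mono fun x =>
    ENNReal.rpow_le_rpow (rpow_tsum_le_tsum_diagSeq _ hq) hp0.le) (by positivity)

theorem tsum_rpow_le_rpow_tsum (y : ℕ → ℝ≥0∞) {t : ℝ} (ht : 1 ≤ t) :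
    ∑' i, y i ^ t ≤ (∑' i, y i) ^ t := by
  have e : ∀ z : ℝ≥0∞, z ^ t = z * z ^ (t - 1) := fun z => by
    have := ENNReal.rpow_add_of_nonneg (x := z) 1 (t - 1) (by norm_num) (by linarith)
    rwa [add_sub_cancel, ENNReal.rpow_one] at this
  simp_rw [e]
  rw [← ENNReal.tsum_mul_right]
  refine ENNReal.tsum_le_tsum fun i => mul_le_mul_right ?_ _
  exact ENNReal.rpow_le_rpow (ENNReal.le_tsum i) (by linarith)

theorem tsum_two_rpow_neg_mul_abs_ne_top {ε : ℝ} (hε : 0 < ε) :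
    ∑' n : ℤ, (2:ℝ≥0∞) ^ (-(ε * |(n:ℝ)|)) ≠ ⊤ := by
  have h : ∀ n : ℤ, (2:ℝ≥0∞) ^ (-(ε * |(n:ℝ)|)) = ENNReal.ofReal ((2:ℝ) ^ (-(ε * |(n:ℝ)|))) :=
    fun n => (ofReal_two_rpow _).symm
  simp_rw [h]
  have hnat : Summable fun n : ℕ => (2:ℝ) ^ (-(ε * (n:ℝ))) := by
    have h1 : ∀ n : ℕ, (2:ℝ) ^ (-(ε * (n:ℝ))) = ((2:ℝ) ^ (-ε)) ^ n := fun n => by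
      rw [← Real.rpow_natCast, ← Real.rpow_mul (by norm_num), neg_mul]
    simp_rw [h1]
    exact summable_geometric_of_lt_one (by positivity)
      (Real.rpow_lt_one_of_one_lt_of_neg (by norm_num) (by linarith))
  have hs : Summable fun n : ℤ => (2:ℝ) ^ (-(ε * |(n:ℝ)|)) := by
    refine Summable.of_nat_of_neg ?_ ?_ <;> simpa using hnat
  exact hs.tsum_ofReal_ne_top

/-- Control of the array `T` by averages of `u`, with the exponent `r`. -/
def AvgBound (K : ℝ≥0∞) (r : ℝ) (u : ℕ → ℝ → ℝ≥0∞) (T : ℕ → ℕ → ℕ → ℝ → ℝ≥0∞) : Prop :=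
  ∀ k j l x, T k j l x ^ r ≤ K *
    (2 ^ (r * min ((k:ℝ) - j) 0) * 2 ^ (r * min ((l:ℝ) - j) (-(1 - 1 / r) * ((l:ℝ) - j)))) *
    kernelAvg (etaKernel (2 ^ min k j)) (kernelAvg (etaKernel (2 ^ min j l)) (fun z => u l z ^ r)) x

theorem diagSeq_rpow_le {K : ℝ≥0∞} {r s : ℝ} (hr : 1 ≤ r) {u : ℕ → ℝ → ℝ≥0∞}
    {T : ℕ → ℕ → ℕ → ℝ → ℝ≥0∞} (hu : ∀ l, Measurable (u l)) (hT : AvgBound K r u T)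
    (a b : ℤ) (j : ℕ) (x : ℝ) :
    diagSeq (fun k j l => 2 ^ ((k:ℝ) * s) * T k j l x) a b j ^ r ≤
      K * (2 ^ (r * (a * s + min (a:ℝ) 0)) * 2 ^ (r * (b * (-s - 1 + 1 / r)))) *
      kernelAvg (etaKernel (2 ^ min ((j:ℤ) + a).toNat j))
        (kernelAvg (etaKernel (2 ^ min j ((j:ℤ) + b).toNat))
          (fun z => shiftSeq b (fun l => (2 ^ ((l:ℝ) * s) * u l z) ^ r) j)) x := by
  have hr0 : 0 < r := by linarith
  unfold diagSeq shiftSeq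
  split_ifs with h h' h'
  · set k := ((j:ℤ) + a).toNat with hk
    set l := ((j:ℤ) + b).toNat with hl
    have hka : (k:ℝ) = j + a := by
      have : (k:ℤ) = j + a := by omega
      exact_mod_cast this
    have hlb : (l:ℝ) = j + b := by
      have : (l:ℤ) = j + b := by omega
      exact_mod_cast this
    have hpull : kernelAvg (etaKernel (2 ^ min k j)) (kernelAvg (etaKernel (2 ^ min j l))
        (fun z => (2 ^ ((l:ℝ) * s) * u l z) ^ r)) x = 2 ^ ((l:ℝ) * s * r) *
        kernelAvg (etaKernel (2 ^ min k j)) (kernelAvg (etaKernel (2 ^ min j l))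
        (fun z => u l z ^ r)) x := by
      have e1 : (fun z => (2 ^ ((l:ℝ) * s) * u l z) ^ r) =
          fun z => (2:ℝ≥0∞) ^ ((l:ℝ) * s * r) * u l z ^ r := by
        ext z
        rw [ENNReal.mul_rpow_of_nonneg _ _ hr0.le, ← ENNReal.rpow_mul]
      have e2 : kernelAvg (etaKernel (2 ^ min j l))
          (fun z => (2:ℝ≥0∞) ^ ((l:ℝ) * s * r) * u l z ^ r) = fun y =>
          (2:ℝ≥0∞) ^ ((l:ℝ) * s * r) * kernelAvg (etaKernel (2 ^ min j l))
            (fun z => u l z ^ r) y :=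
        funext fun y => kernelAvg_const_mul (measurable_etaKernel _) ((hu l).pow_const r) _ y
      rw [e1, e2, kernelAvg_const_mul (measurable_etaKernel _)
        (measurable_kernelAvg (measurable_etaKernel _) ((hu l).pow_const r))]
    rw [hpull, ENNReal.mul_rpow_of_nonneg _ _ hr0.le, ← ENNReal.rpow_mul]
    refine (mul_le_mul_right (hT k j l x) _).trans ?_
    set A := kernelAvg (etaKernel (2 ^ min k j)) (kernelAvg (etaKernel (2 ^ min j l))
        (fun z => u l z ^ r)) x
    have e : ∀ P Q R S : ℝ≥0∞, P * (K * (Q * R) * A) = K * A * (P * Q * R) := fun P Q R S => by ring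
    have e' : ∀ P Q R : ℝ≥0∞, K * (P * Q) * (R * A) = K * A * (R * P * Q) := fun P Q R => by ring
    rw [e _ _ _ 0, e']
    simp only [← two_rpow_add]
    refine mul_le_mul_right (ENNReal.rpow_le_rpow_of_exponent_le (by norm_num) ?_) _
    have h1 : min ((l:ℝ) - j) (-(1 - 1 / r) * ((l:ℝ) - j)) ≤ -(1 - 1 / r) * b := by
      refine (min_le_right _ _).trans (le_of_eq ?_)
      rw [hlb]
      ring
    have h2 := mul_le_mul_of_nonneg_left h1 hr0.le
    have h3 : (k:ℝ) - j = a := by rw [hka]; ring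
    rw [h3]
    have h4 : (k:ℝ) * s * r = l * s * r + r * (a * s) - r * (b * s) := by rw [hka, hlb]; ring
    rw [h4]
    have h5 : r * (b * (-s - 1 + 1 / r)) = - (r * (b * s)) + r * (-(1 - 1 / r) * b) := by ring
    rw [h5]
    linarith
  · exact absurd h.2 h'
  · rw [ENNReal.zero_rpow_of_pos hr0]
    exact zero_le
  · rw [ENNReal.zero_rpow_of_pos hr0]
    exact zero_le

theorem rpow_lintegral_const_mul_rpow {S : ℝ → ℝ≥0∞} (hS : Measurable S) {t : ℝ} (ht : 0 < t)
    (c : ℝ≥0∞) : (∫⁻ x, (c * S x) ^ t) ^ (1 / t) = c * (∫⁻ x, S x ^ t) ^ (1 / t) := by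
  simp_rw [ENNReal.mul_rpow_of_nonneg _ _ ht.le]
  rw [lintegral_const_mul _ (hS.pow_const t), ENNReal.mul_rpow_of_nonneg _ _ (by positivity),
    ← ENNReal.rpow_mul, mul_one_div_cancel ht.ne', ENNReal.rpow_one]

theorem measurable_shiftSeq {g : ℕ → ℝ → ℝ≥0∞} (hg : ∀ l, Measurable (g l)) (b : ℤ) (j : ℕ) :
    Measurable fun z => shiftSeq b (fun l => g l z) j := by
  unfold shiftSeq
  split_ifs
  · exact hg _
  · exact measurable_const

theorem monotone_two_pow_min_toNat (a : ℤ) :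
    Monotone fun j : ℕ => (2:ℝ) ^ min ((j:ℤ) + a).toNat j := by
  intro i j hij
  refine pow_le_pow_right₀ one_le_two ?_
  omega

/-- The size of one diagonal in $L^p(\ell^q)$, with a constant growing in `b`. -/
theorem lintegral_diagSeq_le_of_avgBound {K : ℝ≥0∞} {p q s : ℝ} (hq : 1 ≤ q) (hqp : q < p)
    {u : ℕ → ℝ → ℝ≥0∞} {T : ℕ → ℕ → ℕ → ℝ → ℝ≥0∞} (hu : ∀ l, Measurable (u l))
    (hT : AvgBound K q u T) (a b : ℤ) :
    (∫⁻ x, (∑' j, diagSeq (fun k j l => 2 ^ ((k:ℝ) * s) * T k j l x) a b j ^ q) ^ (p / q)) ^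
        (1 / p) ≤
      (K * (8 * (ENNReal.ofReal (p / q) * 2 ^ (p / q))) ^ 2) ^ (1 / q) *
      (2 ^ (a * s + min (a:ℝ) 0) * 2 ^ (b * (-s - 1 + 1 / q))) *
      (∫⁻ x, (∑' l : ℕ, (2 ^ ((l:ℝ) * s) * u l x) ^ q) ^ (p / q)) ^ (1 / p) := by
  have hq0 : 0 < q := by linarith
  have hp0 : 0 < p := by linarith
  have ht : 1 < p / q := (one_lt_div hq0).mpr hqp
  set t := p / q with htdef
  set M : ℝ≥0∞ := 8 * (ENNReal.ofReal t * 2 ^ t)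
  set c : ℝ≥0∞ := K * (2 ^ (q * (a * s + min (a:ℝ) 0)) * 2 ^ (q * (b * (-s - 1 + 1 / q))))
    with hc
  set G : ℕ → ℝ → ℝ≥0∞ := fun j z => shiftSeq b (fun l => (2 ^ ((l:ℝ) * s) * u l z) ^ q) j
  have hG : ∀ j, Measurable (G j) := fun j =>
    measurable_shiftSeq (g := fun l z => (2 ^ ((l:ℝ) * s) * u l z) ^ q)
      (fun l => ((hu l).const_mul _).pow_const q) b j
  set R : ℕ → ℝ := fun j => 2 ^ min ((j:ℤ) + a).toNat j
  set Q : ℕ → ℝ := fun j => 2 ^ min j ((j:ℤ) + b).toNat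
  have hRm : Monotone R := monotone_two_pow_min_toNat a
  have hQm : Monotone Q := by
    have := monotone_two_pow_min_toNat b
    simp_rw [min_comm _ (_ : ℕ)] at this
    exact this
  have hR0 : ∀ j, 0 < R j := fun j => by positivity
  have hQ0 : ∀ j, 0 < Q j := fun j => by positivity
  have hGQ : ∀ j, Measurable (kernelAvg (etaKernel (Q j)) (G j)) := fun j =>
    measurable_kernelAvg (measurable_etaKernel _) (hG j)
  have key : (∫⁻ x, (∑' j, diagSeq (fun k j l => 2 ^ ((k:ℝ) * s) * T k j l x) a b j ^ q) ^ t) ^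
      (1 / t) ≤ c * (M * (M * (∫⁻ x, (∑' l : ℕ, (2 ^ ((l:ℝ) * s) * u l x) ^ q) ^ t) ^ (1 / t))) := by
    calc _ ≤ (∫⁻ x, (c * ∑' j, kernelAvg (etaKernel (R j))
            (kernelAvg (etaKernel (Q j)) (G j)) x) ^ t) ^ (1 / t) := by
          refine ENNReal.rpow_le_rpow (lintegral_mono fun x => ENNReal.rpow_le_rpow ?_
            (by linarith)) (by positivity)
          rw [← ENNReal.tsum_mul_left]
          exact ENNReal.tsum_le_tsum fun j => diagSeq_rpow_le hq hu hT a b j x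
      _ = c * (∫⁻ x, (∑' j, kernelAvg (etaKernel (R j))
            (kernelAvg (etaKernel (Q j)) (G j)) x) ^ t) ^ (1 / t) :=
          rpow_lintegral_const_mul_rpow (Measurable.tsum fun j =>
            measurable_kernelAvg (measurable_etaKernel _) (hGQ j)) (by linarith) c
      _ ≤ c * (M * (M * (∫⁻ x, (∑' j, G j x) ^ t) ^ (1 / t))) := by
          refine mul_le_mul_right ((lintegral_rpow_tsum_etaKernel_le ht hGQ hR0 hRm).trans
            (mul_le_mul_right ?_ _)) _
          exact lintegral_rpow_tsum_etaKernel_le ht hG hQ0 hQm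
      _ ≤ _ := by
          refine mul_le_mul_right (mul_le_mul_right (mul_le_mul_right (ENNReal.rpow_le_rpow
            (lintegral_mono fun x => ENNReal.rpow_le_rpow ?_ (by linarith)) (by positivity)) _) _) _
          exact tsum_shiftSeq_le b _
  have hexp : ∀ y : ℝ≥0∞, y ^ (1 / p) = (y ^ (1 / t)) ^ (1 / q) := fun y => by
    rw [← ENNReal.rpow_mul, htdef]
    congr 1
    field_simp
  rw [hexp, hexp (∫⁻ x, (∑' l : ℕ, (2 ^ ((l:ℝ) * s) * u l x) ^ q) ^ t)]
  refine (ENNReal.rpow_le_rpow key (by positivity : 0 ≤ 1 / q)).trans (le_of_eq ?_)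
  rw [← mul_assoc, ← mul_assoc, ENNReal.mul_rpow_of_nonneg _ _ (by positivity : 0 ≤ 1 / q)]
  congr 1
  rw [show c * M * M = K * M ^ 2 *
    (2 ^ (q * (a * s + min (a:ℝ) 0)) * 2 ^ (q * (b * (-s - 1 + 1 / q)))) by rw [hc]; ring,
    ENNReal.mul_rpow_of_nonneg _ _ (by positivity : 0 ≤ 1 / q)]
  congr 1
  rw [ENNReal.mul_rpow_of_nonneg _ _ (by positivity : 0 ≤ 1 / q), ← ENNReal.rpow_mul,
    ← ENNReal.rpow_mul]
  congr 2 <;> field_simp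

/-- The size of one diagonal in $L^p(\ell^q)$ when few values of `j` are active. -/
theorem lintegral_diagSeq_le_of_card_le {K : ℝ≥0∞} {p q s : ℝ} (hq : 1 ≤ q) (hqp : q < p)
    {u : ℕ → ℝ → ℝ≥0∞} {T : ℕ → ℕ → ℕ → ℝ → ℝ≥0∞} (hu : ∀ l, Measurable (u l))
    (hTm : ∀ k j l, Measurable (T k j l))
    (hT : AvgBound K p u T) {N : ℕ} {H : Finset ℕ} (hH : H.card ≤ 2 ^ N)
    (hTH : ∀ k j l x, j ∉ H → T k j l x = 0) (a b : ℤ) :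
    (∫⁻ x, (∑' j, diagSeq (fun k j l => 2 ^ ((k:ℝ) * s) * T k j l x) a b j ^ q) ^ (p / q)) ^
        (1 / p) ≤
      (K * 256) ^ (1 / p) * 2 ^ ((N:ℝ) * (1 / q - 1 / p)) *
      (2 ^ (a * s + min (a:ℝ) 0) * 2 ^ (b * (-s - 1 + 1 / p))) *
      (∫⁻ x, (∑' l : ℕ, (2 ^ ((l:ℝ) * s) * u l x) ^ q) ^ (p / q)) ^ (1 / p) := by
  have hq0 : 0 < q := by linarith
  have hp0 : 0 < p := by linarith
  have ht : 1 < p / q := (one_lt_div hq0).mpr hqp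
  set t := p / q with htdef
  have hqt : ∀ y : ℝ≥0∞, (y ^ q) ^ t = y ^ p := fun y => by
    rw [← ENNReal.rpow_mul, htdef]
    congr 1
    field_simp
  set D : ℕ → ℝ → ℝ≥0∞ := fun j x => diagSeq (fun k j l => 2 ^ ((k:ℝ) * s) * T k j l x) a b j
    with hDdef
  have hDm : ∀ j, Measurable (D j) := by
    intro j
    simp only [hDdef, diagSeq]
    split_ifs
    · exact (hTm _ _ _).const_mul _
    · exact measurable_const
  have hD0 : ∀ j x, j ∉ H → D j x = 0 := by
    intro j x hj
    simp only [hDdef, diagSeq, hTH _ j _ x hj, mul_zero, ite_self]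
  set c : ℝ≥0∞ := K * (2 ^ (p * (a * s + min (a:ℝ) 0)) * 2 ^ (p * (b * (-s - 1 + 1 / p))))
    with hc
  set G : ℕ → ℝ → ℝ≥0∞ := fun j z => shiftSeq b (fun l => (2 ^ ((l:ℝ) * s) * u l z) ^ p) j
  have hG : ∀ j, Measurable (G j) := fun j =>
    measurable_shiftSeq (g := fun l z => (2 ^ ((l:ℝ) * s) * u l z) ^ p)
      (fun l => ((hu l).const_mul _).pow_const p) b j
  have h1 : ∀ x, (∑' j, D j x ^ q) ^ t ≤ (2 ^ N) ^ (t - 1) * ∑' j, D j x ^ p := by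
    intro x
    rw [tsum_eq_sum (s := H) (fun j hj => by rw [hD0 j x hj, ENNReal.zero_rpow_of_pos hq0])]
    refine (ENNReal.rpow_sum_le_const_mul_sum_rpow H _ ht.le).trans ?_
    refine mul_le_mul' (ENNReal.rpow_le_rpow (by exact_mod_cast hH) (by linarith)) ?_
    simp_rw [hqt]
    exact ENNReal.sum_le_tsum _
  have h2 : ∀ j, ∫⁻ x, D j x ^ p ≤ c * 256 * ∫⁻ x, G j x := by
    intro j
    have hη : ∀ n : ℕ, ∫⁻ z, etaKernel (2 ^ n) z ≤ 16 := fun n =>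
      lintegral_etaKernel_le (by positivity)
    refine (lintegral_mono fun x => diagSeq_rpow_le (by linarith) hu hT a b j x).trans ?_
    rw [lintegral_const_mul _ (measurable_kernelAvg (measurable_etaKernel _)
      (measurable_kernelAvg (measurable_etaKernel _) (hG j))),
      lintegral_kernelAvg (measurable_etaKernel _)
      (measurable_kernelAvg (measurable_etaKernel _) (hG j)),
      lintegral_kernelAvg (measurable_etaKernel _) (hG j), mul_assoc c]
    refine mul_le_mul_right ?_ _
    rw [← mul_assoc]
    refine mul_le_mul_left ((mul_le_mul' (hη _) (hη _)).trans (by norm_num)) _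
  have h3 : ∫⁻ x, (∑' j, D j x ^ q) ^ t ≤ (2 ^ N) ^ (t - 1) * (c * 256 *
      ∫⁻ x, (∑' l : ℕ, (2 ^ ((l:ℝ) * s) * u l x) ^ q) ^ t) := by
    refine (lintegral_mono h1).trans ?_
    rw [lintegral_const_mul _ (Measurable.tsum fun j => (hDm j).pow_const p),
      lintegral_tsum fun j => ((hDm j).pow_const p).aemeasurable]
    refine mul_le_mul_right ((ENNReal.tsum_le_tsum h2).trans ?_) _
    rw [ENNReal.tsum_mul_left, ← lintegral_tsum fun j => (hG j).aemeasurable]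
    refine mul_le_mul_right (lintegral_mono fun x => ?_) _
    refine (tsum_shiftSeq_le b _).trans ?_
    simp_rw [← hqt]
    exact tsum_rpow_le_rpow_tsum _ ht.le
  have hip : 0 ≤ 1 / p := by positivity
  refine (ENNReal.rpow_le_rpow h3 hip).trans (le_of_eq ?_)
  rw [← mul_assoc, ENNReal.mul_rpow_of_nonneg _ _ hip]
  congr 1
  rw [show ((2:ℝ≥0∞) ^ N) ^ (t - 1) * (c * 256) = K * 256 * (2 ^ N) ^ (t - 1) *
    (2 ^ (p * (a * s + min (a:ℝ) 0)) * 2 ^ (p * (b * (-s - 1 + 1 / p)))) by rw [hc]; ring,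
    ENNReal.mul_rpow_of_nonneg _ _ hip, ENNReal.mul_rpow_of_nonneg _ _ hip]
  congr 1
  · congr 1
    rw [← ENNReal.rpow_natCast, ← ENNReal.rpow_mul, ← ENNReal.rpow_mul, htdef]
    congr 1
    field_simp
  · rw [ENNReal.mul_rpow_of_nonneg _ _ hip, ← ENNReal.rpow_mul, ← ENNReal.rpow_mul]
    congr 2 <;> field_simp

theorem mul_add_min_zero_le {s : ℝ} (a : ℝ) :
    a * s + min a 0 ≤ -(min (-s) (1 + s) * |a|) := by
  rcases le_total 0 a with h | h
  · rw [min_eq_right h, abs_of_nonneg h]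
    nlinarith [min_le_left (-s) (1 + s)]
  · rw [min_eq_left h, abs_of_nonpos h]
    nlinarith [min_le_right (-s) (1 + s)]

/-- Bound for a single diagonal, obtained from the exponent `q` below the level `N` and from the
exponent `p` above it. -/
theorem lintegral_diagSeq_le {p q s : ℝ} (hq : 1 < q) (hqp : q < p) {K A : ℝ≥0∞}
    (hA₁ : (K * (8 * (ENNReal.ofReal (p / q) * 2 ^ (p / q))) ^ 2) ^ (1 / q) ≤ A)
    (hA₂ : (K * 256) ^ (1 / p) ≤ A) {N : ℕ} {H : Finset ℕ} (hH : H.card ≤ 2 ^ N)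
    {u : ℕ → ℝ → ℝ≥0∞} {T : ℕ → ℕ → ℕ → ℝ → ℝ≥0∞} (hu : ∀ l, Measurable (u l))
    (hTm : ∀ k j l, Measurable (T k j l)) (hTq : AvgBound K q u T) (hTp : AvgBound K p u T)
    (hTH : ∀ k j l x, j ∉ H → T k j l x = 0) {ε ε' : ℝ} (hε₁ : ε ≤ -s - 1 + 1 / q)
    (hε₂ : ε ≤ s + 1 - 1 / p) (hε' : ε' = min (-s) (1 + s)) (a b : ℤ) :
    (∫⁻ x, (∑' j, diagSeq (fun k j l => 2 ^ ((k:ℝ) * s) * T k j l x) a b j ^ q) ^ (p / q)) ^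
      (1 / p) ≤
    A * (∫⁻ x, (∑' l : ℕ, (2 ^ ((l:ℝ) * s) * u l x) ^ q) ^ (p / q)) ^ (1 / p) *
      2 ^ ((N:ℝ) * (-s - 1 + 1 / q)) *
      (2 ^ (-(ε' * |(a:ℝ)|)) * 2 ^ (-(ε * |((b - N : ℤ):ℝ)|))) := by
  generalize hX : (∫⁻ x, (∑' l : ℕ, (2 ^ ((l:ℝ) * s) * u l x) ^ q) ^ (p / q)) ^ (1 / p) = X
  have ha : (2:ℝ≥0∞) ^ (a * s + min (a:ℝ) 0) ≤ 2 ^ (-(ε' * |(a:ℝ)|)) :=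
    ENNReal.rpow_le_rpow_of_exponent_le (by norm_num) (hε' ▸ mul_add_min_zero_le _)
  have e : ∀ P Q R : ℝ≥0∞, A * (P * (Q * R)) * X = A * X * Q * (P * R) := fun P Q R => by ring
  rw [← e]
  push_cast
  rcases le_total b N with hb | hb
  · have hb' : (b:ℝ) ≤ N := by exact_mod_cast hb
    have hb2 : (2:ℝ≥0∞) ^ (b * (-s - 1 + 1 / q)) ≤
        2 ^ ((N:ℝ) * (-s - 1 + 1 / q)) * 2 ^ (-(ε * |(b:ℝ) - N|)) := by
      rw [← two_rpow_add]
      refine ENNReal.rpow_le_rpow_of_exponent_le (by norm_num) ?_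
      rw [abs_of_nonpos (by linarith)]
      linarith [mul_le_mul_of_nonneg_left hε₁ (sub_nonneg.mpr hb')]
    have h := lintegral_diagSeq_le_of_avgBound hq.le hqp hu hTq a b (s := s)
    rw [hX] at h
    exact h.trans (mul_le_mul_left (mul_le_mul' hA₁ (mul_le_mul' ha hb2)) X)
  · have hb' : (N:ℝ) ≤ b := by exact_mod_cast hb
    have hb2 : (2:ℝ≥0∞) ^ ((N:ℝ) * (1 / q - 1 / p)) * 2 ^ (b * (-s - 1 + 1 / p)) ≤
        2 ^ ((N:ℝ) * (-s - 1 + 1 / q)) * 2 ^ (-(ε * |(b:ℝ) - N|)) := by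
      rw [← two_rpow_add, ← two_rpow_add]
      refine ENNReal.rpow_le_rpow_of_exponent_le (by norm_num) ?_
      rw [abs_of_nonneg (by linarith)]
      linarith [mul_le_mul_of_nonneg_left hε₂ (sub_nonneg.mpr hb')]
    have h := lintegral_diagSeq_le_of_card_le hq.le hqp hu hTm hTp hH hTH a b (s := s)
    rw [hX] at h
    have e' : ∀ P Q R S : ℝ≥0∞, P * Q * (R * S) * X = P * (R * (Q * S)) * X :=
      fun P Q R S => by ring
    rw [e'] at h
    exact h.trans (mul_le_mul_left (mul_le_mul' hA₂ (mul_le_mul' ha hb2)) X)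

/-- The discrete form of the main estimate. -/
theorem exists_lintegral_rpow_tsum_le {p q s : ℝ} (hq : 1 < q) (hqp : q < p)
    (hs1 : -(1 - 1/p) < s) (hs2 : s < -(1 - 1/q)) {K : ℝ≥0∞} (hK : K ≠ ⊤) :
    ∃ C : ℝ≥0∞, C ≠ ⊤ ∧ ∀ (N : ℕ) (H : Finset ℕ), H.card ≤ 2 ^ N →
      ∀ (u : ℕ → ℝ → ℝ≥0∞) (T : ℕ → ℕ → ℕ → ℝ → ℝ≥0∞), (∀ l, Measurable (u l)) →
      (∀ k j l, Measurable (T k j l)) → AvgBound K q u T → AvgBound K p u T →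
      (∀ k j l x, j ∉ H → T k j l x = 0) →
      (∫⁻ x, (∑' k : ℕ, (2 ^ ((k:ℝ) * s) * ∑' j, ∑' l, T k j l x) ^ q) ^ (p / q)) ^ (1 / p) ≤
        C * 2 ^ ((N:ℝ) * (-s - 1 + 1 / q)) *
        (∫⁻ x, (∑' l : ℕ, (2 ^ ((l:ℝ) * s) * u l x) ^ q) ^ (p / q)) ^ (1 / p) := by
  have hq0 : 0 < q := by linarith
  have hp0 : 0 < p := by linarith
  have hs0 : 0 < -s := by
    have : 1 / q < 1 := (div_lt_one hq0).mpr hq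
    linarith
  have hs0' : 0 < 1 + s := by
    have : 0 < 1 / p := by positivity
    linarith
  obtain ⟨ε, hε0, hε⟩ := exists_between (lt_min (a := (0:ℝ)) (b := -s - 1 + 1 / q)
    (c := s + 1 - 1 / p) (by linarith) (by linarith))
  obtain ⟨hε₁, hε₂⟩ := lt_min_iff.mp hε
  obtain ⟨ε', hε'⟩ : ∃ ε', ε' = min (-s) (1 + s) := ⟨_, rfl⟩
  have hε'0 : 0 < ε' := hε' ▸ lt_min hs0 hs0'
  obtain ⟨A, hAtop, hA₁, hA₂⟩ : ∃ A : ℝ≥0∞, A ≠ ⊤ ∧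
      (K * (8 * (ENNReal.ofReal (p / q) * 2 ^ (p / q))) ^ 2) ^ (1 / q) ≤ A ∧
      (K * 256) ^ (1 / p) ≤ A := by
    have h2 : (2:ℝ≥0∞) ^ (p / q) ≠ ⊤ := ENNReal.rpow_ne_top_of_nonneg (by positivity) (by norm_num)
    refine ⟨_, ENNReal.add_ne_top.mpr ⟨ENNReal.rpow_ne_top_of_nonneg (by positivity) ?_,
      ENNReal.rpow_ne_top_of_nonneg (by positivity) (ENNReal.mul_ne_top hK (by norm_num))⟩,
      le_self_add, le_add_self⟩
    exact ENNReal.mul_ne_top hK (ENNReal.pow_ne_top (ENNReal.mul_ne_top (by norm_num)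
      (ENNReal.mul_ne_top ENNReal.ofReal_ne_top h2)))
  refine ⟨A * (∑' n : ℤ, (2:ℝ≥0∞) ^ (-(ε' * |(n:ℝ)|))) * ∑' n : ℤ, (2:ℝ≥0∞) ^ (-(ε * |(n:ℝ)|)),
    ENNReal.mul_ne_top (ENNReal.mul_ne_top hAtop
    (tsum_two_rpow_neg_mul_abs_ne_top hε'0)) (tsum_two_rpow_neg_mul_abs_ne_top hε0), ?_⟩
  intro N H hH u T hu hTm hTq hTp hTH
  have hterm := lintegral_diagSeq_le hq hqp hA₁ hA₂ hH hu hTm hTq hTp hTH hε₁.le hε₂.le hε'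
  have hmul : ∀ x (k : ℕ), 2 ^ ((k:ℝ) * s) * ∑' j, ∑' l, T k j l x =
      ∑' j, ∑' l, 2 ^ ((k:ℝ) * s) * T k j l x := fun x k => by
    simp_rw [ENNReal.tsum_mul_left]
  simp_rw [hmul]
  refine (lintegral_rpow_tsum_le_tsum_diagSeq (T := fun k j l x => 2 ^ ((k:ℝ) * s) * T k j l x)
    (fun k j l => (hTm k j l).const_mul _) hq.le hqp.le).trans ?_
  generalize (∫⁻ x, (∑' l : ℕ, (2 ^ ((l:ℝ) * s) * u l x) ^ q) ^ (p / q)) ^ (1 / p) = X at hterm ⊢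
  refine (ENNReal.tsum_le_tsum (g := fun ab : ℤ × ℤ => A * X * 2 ^ ((N:ℝ) * (-s - 1 + 1 / q)) *
    (2 ^ (-(ε' * |(ab.1:ℝ)|)) * 2 ^ (-(ε * |((ab.2 - N : ℤ):ℝ)|)))) fun ab => ?_).trans
    (le_of_eq ?_)
  · exact hterm ab.1 ab.2
  rw [ENNReal.tsum_mul_left, ENNReal.tsum_prod']
  simp only [ENNReal.tsum_mul_left]
  have hshift : ∑' b : ℤ, (2:ℝ≥0∞) ^ (-(ε * |((b - N : ℤ):ℝ)|)) =
      ∑' n : ℤ, (2:ℝ≥0∞) ^ (-(ε * |(n:ℝ)|)) :=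
    (Equiv.subRight (N:ℤ)).tsum_eq (fun n : ℤ => (2:ℝ≥0∞) ^ (-(ε * |(n:ℝ)|)))
  rw [hshift, ENNReal.tsum_mul_right]
  ring

theorem conv_haarProj (E : Finset (ℕ × ℤ)) (f : ℝ → ℂ) {κ : ℝ → ℂ} (hκ : Measurable κ) {A : ℝ}
    (hA : ∀ x, ‖κ x‖ ≤ A) (x : ℝ) :
    conv (haarProj E f) κ x = ∑ e ∈ E, (2:ℂ) ^ e.1 * (∫ y, f y * haarFn e.1 e.2 y) *
      conv (haarFn e.1 e.2) κ x := by
  unfold conv haarProj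
  simp_rw [Finset.sum_mul]
  rw [integral_finsetSum]
  · refine Finset.sum_congr rfl fun e _ => ?_
    simp only [mul_assoc]
    rw [integral_const_mul, integral_const_mul]
  · intro e _
    have h := (integrable_haarFn e.1 e.2).bdd_mul (f := fun t => κ (x - t)) (c := A)
      (hκ.comp (measurable_const.sub measurable_id)).aestronglyMeasurable
      (Filter.Eventually.of_forall fun t => hA _)
    refine (h.const_mul ((2:ℂ) ^ e.1 * ∫ y, f y * haarFn e.1 e.2 y)).congr
      (Filter.Eventually.of_forall fun t => ?_)
    simp only
    ring

/-- The positions occurring in `E` at the Haar frequency `j`. -/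
def haarSlice (E : Finset (ℕ × ℤ)) (j : ℕ) : Finset ℤ := (E.filter fun e => e.1 = j).image Prod.snd

theorem sum_eq_sum_haarSlice (E : Finset (ℕ × ℤ)) (F : ℕ → ℤ → ℝ≥0∞) :
    ∑ e ∈ E, F e.1 e.2 = ∑ j ∈ HFset E, ∑ μ ∈ haarSlice E j, F j μ := by
  rw [← Finset.sum_fiberwise_of_maps_to (t := HFset E) (g := Prod.fst)
    (fun e he => Finset.mem_image_of_mem _ he)]
  refine Finset.sum_congr rfl fun j _ => ?_
  rw [haarSlice, Finset.sum_image]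
  · refine Finset.sum_congr rfl fun e he => ?_
    rw [(Finset.mem_filter.mp he).2]
  · intro e he e' he' h
    have h1 := (Finset.mem_filter.mp he).2
    have h2 := (Finset.mem_filter.mp he').2
    exact Prod.ext (h1.trans h2.symm) h

theorem haarSlice_eq_empty {E : Finset (ℕ × ℤ)} {j : ℕ} (hj : j ∉ HFset E) :
    haarSlice E j = ∅ := by
  rw [haarSlice, Finset.image_eq_empty, Finset.filter_eq_empty_iff]
  intro e he h
  exact hj (h ▸ Finset.mem_image_of_mem _ he)

theorem FNorm_eq_lintegral (φ₀ : ℝ → ℂ) (p s : ℝ) {q : ℝ} (hq : 0 < q) (g : ℝ → ℂ) :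
    FNorm φ₀ p q s g =
      (∫⁻ x, (∑' k : ℕ, (2 ^ ((k:ℝ) * s) * ‖LPop φ₀ k g x‖ₑ) ^ q) ^ (p / q)) ^ (1 / p) := by
  unfold FNorm
  simp_rw [ENNReal.mul_rpow_of_nonneg _ _ hq.le, ← ENNReal.rpow_mul, ofReal_two_rpow, ofReal_norm]

theorem AvgBound.mono {K K' : ℝ≥0∞} (h : K ≤ K') {r : ℝ} {u : ℕ → ℝ → ℝ≥0∞}
    {T : ℕ → ℕ → ℕ → ℝ → ℝ≥0∞} (hT : AvgBound K r u T) : AvgBound K' r u T :=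
  fun k j l x => (hT k j l x).trans (by gcongr)

theorem exists_norm_dilKernel_le (κ₀ κ₁ : SchwartzMap ℝ ℂ) (k : ℕ) :
    ∃ A : ℝ, ∀ x, ‖dilKernel κ₀ κ₁ k x‖ ≤ A := by
  obtain ⟨A₀, h₀⟩ : ∃ A₀ : ℝ, ∀ x, ‖κ₀ x‖ ≤ A₀ :=
    ⟨_, κ₀.toBoundedContinuousFunction.norm_coe_le_norm⟩
  obtain ⟨A₁, h₁⟩ : ∃ A₁ : ℝ, ∀ x, ‖κ₁ x‖ ≤ A₁ :=
    ⟨_, κ₁.toBoundedContinuousFunction.norm_coe_le_norm⟩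
  rcases eq_or_ne k 0 with rfl | hk
  · exact ⟨A₀, fun x => by simpa [dilKernel] using h₀ x⟩
  · refine ⟨2 ^ k * A₁, fun x => ?_⟩
    simpa [dilKernel, hk] using h₁ (2 ^ k * x)

/-- Pointwise domination of a convolution of a Haar projection, given a domination `c` of the
Haar coefficients. -/
theorem enorm_conv_haarProj_le (E : Finset (ℕ × ℤ)) (f : ℝ → ℂ) {κ : ℝ → ℂ} (hκ : Measurable κ)
    {A : ℝ} (hA : ∀ x, ‖κ x‖ ≤ A) {c : ℕ → ℕ → ℤ → ℝ≥0∞}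
    (hc : ∀ j μ, ‖∫ y, f y * haarFn j μ y‖ₑ ≤ ∑' l, c l j μ) (x : ℝ) :
    ‖conv (haarProj E f) κ x‖ₑ ≤
      ∑' j, ∑' l, ∑ μ ∈ haarSlice E j, (2 ^ j * c l j μ) * ‖conv (haarFn j μ) κ x‖ₑ := by
  rw [conv_haarProj E f hκ hA]
  calc _ ≤ ∑ e ∈ E, 2 ^ e.1 * (∑' l, c l e.1 e.2) * ‖conv (haarFn e.1 e.2) κ x‖ₑ := by
        refine (enorm_sum_le _ _).trans (Finset.sum_le_sum fun e _ => ?_)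
        rw [enorm_mul, enorm_mul, enorm_pow]
        have h2 : ‖(2:ℂ)‖ₑ = 2 := by
          rw [← ofReal_norm]
          simp
        rw [h2]
        gcongr
        exact hc _ _
    _ = ∑ j ∈ HFset E, ∑' l, ∑ μ ∈ haarSlice E j,
          (2 ^ j * c l j μ) * ‖conv (haarFn j μ) κ x‖ₑ := by
        rw [sum_eq_sum_haarSlice E fun j μ => 2 ^ j * (∑' l, c l j μ) * ‖conv (haarFn j μ) κ x‖ₑ]
        refine Finset.sum_congr rfl fun j _ => ?_
        rw [Summable.tsum_finsetSum fun _ _ => ENNReal.summable]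
        simp only [ENNReal.tsum_mul_left, ENNReal.tsum_mul_right]
    _ ≤ _ := ENNReal.sum_le_tsum _

/-- Upper bound for Haar projections on $F^s_{p,q}$, $1<q<p<\infty$,
$-(1-1/p)<s<-(1-1/q)$: $\|P_E f\|\le C 2^{N(-s-1+1/q)}\|f\|$ whenever
$\#\mathrm{HF}(E)\le 2^N$. -/
theorem haar_projection_upper_bound
    (p q s : ℝ) (hq : 1 < q) (hqp : q < p)
    (hs1 : -(1 - 1/p) < s) (hs2 : s < -(1 - 1/q))
    (φ₀ : ℝ → ℂ) (hφsmooth : ContDiff ℝ (⊤ : ℕ∞) φ₀) (hφcpt : HasCompactSupport φ₀)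
    (hφone : ∀ ξ : ℝ, |ξ| ≤ 4/3 → φ₀ ξ = 1)
    (hφzero : ∀ ξ : ℝ, 3/2 ≤ |ξ| → φ₀ ξ = 0) :
    ∃ C : ℝ, 0 < C ∧ ∀ (N : ℕ), 1 ≤ N → ∀ (E : Finset (ℕ × ℤ)),
      (HFset E).card ≤ 2^N → ∀ f : SchwartzMap ℝ ℂ,
      FNorm φ₀ p q s (haarProj E f) ≤
        ENNReal.ofReal (C * (2:ℝ)^((N:ℝ)*(-s-1+1/q))) * FNorm φ₀ p q s f := by
  have hq0 : 0 < q := by linarith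
  have hp0 : 0 < p := by linarith
  obtain ⟨κ₀, κ₁, Ψ, ν₀, ν₁, Θ, hΨ, hΘ, hLP, hcont, hdual, hres⟩ :=
    exists_LPop_structure φ₀ hφsmooth hφcpt hφone hφzero
  obtain ⟨C', -, hv₁, hv₂, -⟩ := exists_conv_haarFn_bounds κ₀ κ₁ Ψ hΨ
  obtain ⟨C, -, hw₁, hw₂, hw₃⟩ := exists_conv_haarFn_bounds ν₀ ν₁ Θ hΘ
  have hκm : ∀ k, Measurable (dilKernel κ₀ κ₁ k) :=
    measurable_dilKernel κ₀.continuous.measurable κ₁.continuous.measurable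
  have hνm : ∀ k, Measurable (dilKernel ν₀ ν₁ k) :=
    measurable_dilKernel ν₀.continuous.measurable ν₁.continuous.measurable
  let K : ℝ → ℝ≥0∞ := fun r => (16 * ENNReal.ofReal C') ^ r * (16 * ENNReal.ofReal C) ^ r
  have hK : ∀ r, 0 < r → K r ≠ ⊤ := fun r hr => ENNReal.mul_ne_top
    (ENNReal.rpow_ne_top_of_nonneg hr.le (ENNReal.mul_ne_top (by norm_num) ENNReal.ofReal_ne_top))
    (ENNReal.rpow_ne_top_of_nonneg hr.le (ENNReal.mul_ne_top (by norm_num) ENNReal.ofReal_ne_top))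
  obtain ⟨B, hB, hmain⟩ := exists_lintegral_rpow_tsum_le hq hqp hs1 hs2
    (ENNReal.add_ne_top.mpr ⟨hK q hq0, hK p hp0⟩)
  refine ⟨B.toReal + 1, by positivity, fun N _ E hE f => ?_⟩
  let u : ℕ → ℝ → ℝ≥0∞ := fun l z => ‖LPop φ₀ l f z‖ₑ
  let c : ℕ → ℕ → ℤ → ℝ≥0∞ := fun l j μ =>
    ∫⁻ z, u l z * ‖conv (haarFn j μ) (dilKernel ν₀ ν₁ l) z‖ₑ
  let T : ℕ → ℕ → ℕ → ℝ → ℝ≥0∞ := fun k j l x => ∑ μ ∈ haarSlice E j,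
    (2 ^ j * c l j μ) * ‖conv (haarFn j μ) (dilKernel κ₀ κ₁ k) x‖ₑ
  have hu : ∀ l, Measurable (u l) := fun l => (hcont f l).measurable.enorm
  have hTm : ∀ k j l, Measurable (T k j l) := fun k j l =>
    Finset.measurable_fun_sum _ fun μ _ => (measurable_conv_haarFn j μ (hκm k)).enorm.const_mul _
  have hT : ∀ r, 1 ≤ r → AvgBound (K r) r u T := fun r hr k j l x =>
    rpow_sum_haar_le (hu l) (fun μ => (measurable_conv_haarFn j μ (hνm l)).enorm) hr
      (fun μ z y => hw₁ l j μ z y) (fun μ z y => hw₂ l j μ z y) (fun μ => hw₃ l j μ)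
      (fun μ z y => hv₁ k j μ z y) (fun μ z y => hv₂ k j μ z y) (haarSlice E j) x
  have hTH : ∀ k j l x, j ∉ HFset E → T k j l x = 0 := fun k j l x hj => by
    simp only [T, haarSlice_eq_empty hj, Finset.sum_empty]
  have hpt : ∀ k x, ‖LPop φ₀ k (haarProj E f) x‖ₑ ≤ ∑' j, ∑' l, T k j l x := fun k x => by
    obtain ⟨A, hA⟩ := exists_norm_dilKernel_le κ₀ κ₁ k
    rw [hLP]
    exact enorm_conv_haarProj_le E f (hκm k) hA
      (fun j μ => (hres f j μ).trans (ENNReal.tsum_le_tsum fun l => hdual f l j μ)) x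
  have hconst : B * 2 ^ ((N:ℝ) * (-s - 1 + 1 / q)) ≤
      ENNReal.ofReal ((B.toReal + 1) * (2:ℝ) ^ ((N:ℝ) * (-s - 1 + 1 / q))) := by
    rw [ENNReal.ofReal_mul (by positivity), ofReal_two_rpow]
    gcongr
    exact (ENNReal.le_ofReal_iff_toReal_le hB (by positivity)).mpr (by linarith)
  rw [FNorm_eq_lintegral φ₀ p s hq0, FNorm_eq_lintegral φ₀ p s hq0]
  refine le_trans ?_ ((hmain N (HFset E) hE u T hu hTm ((hT q hq.le).mono le_self_add)
    ((hT p (hq.trans hqp).le).mono le_add_self) hTH).trans (mul_le_mul_left hconst _))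
  gcongr with x k
  exact hpt k x
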